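/- arXiv:2308.06254 — 2 statements merged into one kernel-verified Lean document; each statement's English description precedes it below -/
import Mathlib

section
/- For every δ ∈ [0,1), every κ ∈ [δ,1], every PCTSP instance, and every feasible solution (x,y) of the PCTSP LP relaxation, there exists a tour whose value (tour cost plus penalties of unvisited vertices) is at most max{ (7−2δ−2κ)/(3−δ), (3−δ)/(3−δ−κ), 1/(1−δ) } · (Σ_{e∈E} c_e x_e + Σ_{v∈V} π_v (1 − y_v)). -/
/-- The edge set of the complete graph on `V`: all 2-element subsets of `V`. -/
def completeEdges (V : Type*) [Fintype V] [DecidableEq V] : Finset (Finset V) :=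
  Finset.univ.powersetCard 2

/-- The cut `δ(S)`: edges of the complete graph with exactly one endpoint in `S`. -/
def cutEdges (V : Type*) [Fintype V] [DecidableEq V] (S : Finset V) : Finset (Finset V) :=
  (completeEdges V).filter (fun e => (e ∩ S).card = 1)

/-- Feasibility for the PCTSP LP relaxation. -/
def IsFeasibleLP {V : Type*} [Fintype V] [DecidableEq V]
    (r : V) (x : Finset V → ℝ) (y : V → ℝ) : Prop :=
  (∀ e ∈ completeEdges V, 0 ≤ x e) ∧ (∀ v : V, 0 ≤ y v) ∧ y r = 1 ∧
  (∀ v : V, v ≠ r → ∑ e ∈ cutEdges V {v}, x e = 2 * y v) ∧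
  (∑ e ∈ cutEdges V {r}, x e ≤ 2) ∧
  (∀ S : Finset V, r ∉ S → ∀ v ∈ S, 2 * y v ≤ ∑ e ∈ cutEdges V S, x e)

/-- The cost of a tour given as a list of (distinct) vertices: the sum of the costs of
consecutive edges, plus the closing edge back to the start if the tour has at least two
vertices. -/
def tourCost {V : Type*} [DecidableEq V] (c : Finset V → ℝ) (t : List V) : ℝ :=
  if t.length ≤ 1 then 0
  else ((t.zip (t.rotate 1)).map (fun p => c {p.1, p.2})).sum

/-- `W` is the vertex set of a tree rooted at `r` whose parent map is `p`. The last condition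
excludes cycles: the only `p`-closed subset of `W \ {r}` is the empty one. -/
def IsRootedTree {V : Type*} [DecidableEq V] (r : V) (W : Finset V) (p : V → V) : Prop :=
  r ∈ W ∧ (∀ u ∈ W, u ≠ r → p u ∈ W) ∧
    ∀ S ⊆ W.erase r, S.Nonempty → ∃ s ∈ S, p s ∉ S

/-- Pruning: childless vertices satisfying `I` can be removed successively. -/
theorem IsRootedTree.exists_pruned {V : Type*} [DecidableEq V] {r : V} {p : V → V} (I : V → Prop)
    (W : Finset V) (hW : IsRootedTree r W p) :
    ∃ W' ⊆ W, IsRootedTree r W' p ∧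
      (∀ u ∈ W', u ≠ r → I u → ∃ b ∈ W', b ≠ r ∧ p b = u) ∧ ∀ u ∈ W, u ∉ W' → I u := by
  induction W using Finset.strongInduction with
  | H W ih =>
    by_cases h : ∀ u ∈ W, u ≠ r → I u → ∃ b ∈ W, b ≠ r ∧ p b = u
    · exact ⟨W, Finset.Subset.refl _, hW, h, fun u hu hu' => absurd hu hu'⟩
    · push Not at h
      obtain ⟨u, hu, hur, hI, hch⟩ := h
      obtain ⟨h1, h2, h3⟩ := hW
      have hT : IsRootedTree r (W.erase u) p := by
        refine ⟨Finset.mem_erase.2 ⟨hur.symm, h1⟩, fun a ha har => ?_, fun S hS hne => ?_⟩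
        · rw [Finset.mem_erase] at ha
          exact Finset.mem_erase.2 ⟨hch a ha.2 har, h2 a ha.2 har⟩
        · exact h3 S (hS.trans (Finset.erase_subset_erase _ (Finset.erase_subset _ _))) hne
      obtain ⟨W', hW', hT', hp', hI'⟩ := ih _ (Finset.erase_ssubset hu) hT
      refine ⟨W', hW'.trans (Finset.erase_subset _ _), hT', hp', fun a ha ha' => ?_⟩
      by_cases hau : a = u
      · exact hau ▸ hI
      · exact hI' a (Finset.mem_erase.2 ⟨hau, ha⟩) ha'

/-- A (possibly contracted) prize-collecting Steiner tree instance on the vertex set `A` with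
edge lengths `w`, halved penalties `q`, Steiner vertices `Z`, and a fractional solution `(x, y)`. -/
structure IsTreeInstance {V : Type*} [DecidableEq V] (r : V) (A Z : Finset V)
    (w x : V → V → ℝ) (q y : V → ℝ) : Prop where
  root_mem : r ∈ A
  root_notMem : r ∉ Z
  w_nonneg : ∀ a ∈ A, ∀ b ∈ A, a ≠ b → 0 ≤ w a b
  w_symm : ∀ a b, w a b = w b a
  w_triangle : ∀ z ∈ A, z ∈ Z → ∀ a ∈ A, ∀ b ∈ A, a ≠ b → a ≠ z → b ≠ z → w a b ≤ w a z + w z b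
  x_nonneg : ∀ a b, 0 ≤ x a b
  x_symm : ∀ a b, x a b = x b a
  x_diag : ∀ a, x a a = 0
  q_nonneg : ∀ a, 0 ≤ q a
  q_root : q r = 0
  q_steiner : ∀ z ∈ Z, q z = 0
  q_notMem : ∀ a, a ∉ A → q a = 0
  y_le_one : ∀ a, y a ≤ 1
  cut : ∀ S ⊆ A, r ∉ S → ∀ t ∈ S, t ∉ Z → 2 * y t ≤ ∑ a ∈ S, ∑ b ∈ A \ S, x a b

/-- There is a tree avoiding the Steiner vertices whose cost is at most that of `(x, y)`. -/
def HasCheapTree {V : Type*} [DecidableEq V] (r : V) (A Z : Finset V)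
    (w x : V → V → ℝ) (q y : V → ℝ) : Prop :=
  ∃ W p, IsRootedTree r W p ∧ W ⊆ A \ Z ∧
    ∑ u ∈ W.erase r, w u (p u) + 2 * ∑ a ∈ A \ W, q a ≤
      (∑ a ∈ A, ∑ b ∈ A, w a b * x a b) / 2 + 2 * ∑ a ∈ A, q a * (1 - y a)

/-- The indicator of the active vertices, those with positive remaining penalty. -/
noncomputable def activity {V : Type*} (q : V → ℝ) (a : V) : ℝ := by
  classical exact if 0 < q a then 1 else 0

theorem activity_of_pos {V : Type*} {q : V → ℝ} {a : V} (h : 0 < q a) : activity q a = 1 := if_pos h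

theorem activity_of_eq_zero {V : Type*} {q : V → ℝ} {a : V} (h : q a = 0) : activity q a = 0 := by
  simp [activity, h]

theorem activity_mem {V : Type*} (q : V → ℝ) (a : V) : 0 ≤ activity q a ∧ activity q a ≤ 1 := by
  unfold activity; split_ifs <;> norm_num

section
variable {V : Type*} [DecidableEq V] {r : V} {A Z : Finset V} {w x : V → V → ℝ} {q y : V → ℝ}

theorem sum_activity_parent_le {W : Finset V} {p : V → V}
    (hq : ∀ a, 0 ≤ q a) (hp : ∀ u ∈ W, u ≠ r → q u = 0 → ∃ b ∈ W, b ≠ r ∧ p b = u) :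
    ∑ u ∈ W.erase r, activity q (p u) ≤ ∑ u ∈ W.erase r, activity q u := by
  classical
  have h1 : ∀ f : V → V, ∑ u ∈ W.erase r, activity q (f u) =
      ((W.erase r).card : ℝ) - (((W.erase r).filter (fun u => q (f u) = 0)).card : ℝ) := by
    intro f
    rw [Finset.card_filter, Finset.card_eq_sum_ones]
    push_cast
    rw [← Finset.sum_sub_distrib]
    refine Finset.sum_congr rfl fun u _ => ?_
    by_cases h : q (f u) = 0
    · simp [activity_of_eq_zero h, h]
    · simp [activity_of_pos (lt_of_le_of_ne (hq _) (Ne.symm h)), h]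
  rw [h1 p, h1 (fun u => u)]
  have h2 : ((W.erase r).filter (fun u => q u = 0)).card ≤
      ((W.erase r).filter (fun u => q (p u) = 0)).card := by
    refine (Finset.card_le_card (t := ((W.erase r).filter (fun u => q (p u) = 0)).image p)
      fun u hu => ?_).trans Finset.card_image_le
    rw [Finset.mem_filter, Finset.mem_erase] at hu
    obtain ⟨b, hb, hbr, rfl⟩ := hp u hu.1.2 hu.1.1 hu.2
    exact Finset.mem_image_of_mem _ (Finset.mem_filter.2 ⟨Finset.mem_erase.2 ⟨hbr, hb⟩, hu.2⟩)
  have h3 : (((W.erase r).filter (fun u => q u = 0)).card : ℝ) ≤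
      ((W.erase r).filter (fun u => q (p u) = 0)).card := by exact_mod_cast h2
  linarith

theorem IsTreeInstance.grow (h : IsTreeInstance r A Z w x q y) {ε : ℝ}
    (hqε : ∀ a ∈ A, 0 < q a → ε ≤ q a)
    (hwε : ∀ a ∈ A, ∀ b ∈ A, a ≠ b → ε * (activity q a + activity q b) ≤ w a b) :
    IsTreeInstance r A Z (fun a b => w a b - ε * (activity q a + activity q b)) x
      (fun a => q a - ε * activity q a) y where
  root_mem := h.root_mem
  root_notMem := h.root_notMem
  w_nonneg a ha b hb hab := by linarith [hwε a ha b hb hab]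
  w_symm a b := by rw [h.w_symm, add_comm]
  w_triangle z hz hzZ a ha b hb hab haz hbz := by
    rw [activity_of_eq_zero (h.q_steiner z hzZ)]
    linarith [h.w_triangle z hz hzZ a ha b hb hab haz hbz]
  x_nonneg := h.x_nonneg
  x_symm := h.x_symm
  x_diag := h.x_diag
  q_nonneg a := by
    rcases (h.q_nonneg a).eq_or_lt with h0 | h0
    · rw [activity_of_eq_zero h0.symm]; linarith
    · rw [activity_of_pos h0]
      by_cases ha : a ∈ A
      · linarith [hqε a ha h0]
      · exact absurd (h.q_notMem a ha) h0.ne'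
  q_root := by rw [activity_of_eq_zero h.q_root, h.q_root]; ring
  q_steiner z hz := by rw [activity_of_eq_zero (h.q_steiner z hz), h.q_steiner z hz]; ring
  q_notMem a ha := by rw [activity_of_eq_zero (h.q_notMem a ha), h.q_notMem a ha]; ring
  y_le_one := h.y_le_one
  cut := h.cut

theorem IsTreeInstance.hasCheapTree_of_grow (h : IsTreeInstance r A Z w x q y) {ε : ℝ} (hε : 0 ≤ ε)
    (hg : IsTreeInstance r A Z (fun a b => w a b - ε * (activity q a + activity q b)) x
      (fun a => q a - ε * activity q a) y)
    (hc : HasCheapTree r A Z (fun a b => w a b - ε * (activity q a + activity q b)) x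
      (fun a => q a - ε * activity q a) y) : HasCheapTree r A Z w x q y := by
  obtain ⟨W₀, p, hT₀, hWA₀, hcost₀⟩ := hc
  obtain ⟨W, hWW, hT, hp, hI⟩ := hT₀.exists_pruned (fun u => q u = 0)
  have hWA := hWW.trans hWA₀
  have hWA' : W ⊆ A := hWA.trans Finset.sdiff_subset
  have hWA₀' : W₀ ⊆ A := hWA₀.trans Finset.sdiff_subset
  refine ⟨W, p, hT, hWA, ?_⟩
  have e1 : ∑ u ∈ W.erase r, (w u (p u) - ε * (activity q u + activity q (p u))) ≤
      ∑ u ∈ W₀.erase r, (w u (p u) - ε * (activity q u + activity q (p u))) := by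
    refine Finset.sum_le_sum_of_subset_of_nonneg (Finset.erase_subset_erase _ hWW) fun u hu _ => ?_
    rw [Finset.mem_erase] at hu
    refine hg.w_nonneg u (hWA₀' hu.2) (p u) (hWA₀' (hT₀.2.1 u hu.2 hu.1)) fun hup => ?_
    obtain ⟨s, hs, hs'⟩ := hT₀.2.2 {u} (by simpa using hu) (by simp)
    simp only [Finset.mem_singleton] at hs hs'
    rw [hs] at hs'
    exact hs' hup.symm
  have e2 : ∑ a ∈ A \ W, (q a - ε * activity q a) = ∑ a ∈ A \ W₀, (q a - ε * activity q a) := by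
    symm
    refine Finset.sum_subset (Finset.sdiff_subset_sdiff (Finset.Subset.refl _) hWW) fun a ha ha' => ?_
    rw [Finset.mem_sdiff] at ha ha'
    have hq0 : q a = 0 := hI a (by tauto) ha.2
    rw [activity_of_eq_zero hq0, hq0]; ring
  have e3 := sum_activity_parent_le h.q_nonneg hp
  have e4 : ∑ a ∈ A, activity q a = ∑ u ∈ W.erase r, activity q u + ∑ a ∈ A \ W, activity q a := by
    rw [← Finset.sum_sdiff hWA', Finset.sum_erase _ (activity_of_eq_zero h.q_root), add_comm]
  have e5 : ∑ a ∈ A, ∑ b ∈ A, (w a b - ε * (activity q a + activity q b)) * x a b =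
      ∑ a ∈ A, ∑ b ∈ A, w a b * x a b - 2 * ε * ∑ a ∈ A, activity q a * ∑ b ∈ A, x a b := by
    have : ∑ a ∈ A, ∑ b ∈ A, activity q b * x a b = ∑ a ∈ A, ∑ b ∈ A, activity q a * x a b := by
      rw [Finset.sum_comm]
      exact Finset.sum_congr rfl fun a _ => Finset.sum_congr rfl fun b _ => by rw [h.x_symm]
    calc _ = ∑ a ∈ A, ∑ b ∈ A, w a b * x a b - ε * ∑ a ∈ A, ∑ b ∈ A, activity q a * x a b
          - ε * ∑ a ∈ A, ∑ b ∈ A, activity q b * x a b := by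
          simp only [Finset.mul_sum, ← Finset.sum_sub_distrib]
          exact Finset.sum_congr rfl fun a _ => Finset.sum_congr rfl fun b _ => by ring
      _ = _ := by rw [this]; simp only [← Finset.mul_sum]; ring
  have e6 : ∑ a ∈ A, activity q a * (2 * y a) ≤ ∑ a ∈ A, activity q a * ∑ b ∈ A, x a b := by
    refine Finset.sum_le_sum fun a ha => ?_
    rcases (h.q_nonneg a).eq_or_lt with h0 | h0
    · rw [activity_of_eq_zero h0.symm]; simp
    · refine mul_le_mul_of_nonneg_left ?_ (activity_mem q a).1
      have har : a ≠ r := fun har => by rw [har, h.q_root] at h0; exact lt_irrefl _ h0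
      have haZ : a ∉ Z := fun haZ => by rw [h.q_steiner a haZ] at h0; exact lt_irrefl _ h0
      have := h.cut {a} (by simpa using ha) (by simpa using har.symm) a (by simp) haZ
      rw [Finset.sum_singleton] at this
      exact this.trans (Finset.sum_le_sum_of_subset_of_nonneg Finset.sdiff_subset
        fun b _ _ => h.x_nonneg a b)
  have e7 : ∑ a ∈ A, (q a - ε * activity q a) * (1 - y a) = ∑ a ∈ A, q a * (1 - y a) -
      ε * ∑ a ∈ A, activity q a + ε / 2 * ∑ a ∈ A, activity q a * (2 * y a) := by
    simp only [Finset.mul_sum, ← Finset.sum_sub_distrib, ← Finset.sum_add_distrib]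
    exact Finset.sum_congr rfl fun a _ => by ring
  rw [e5, e7, ← e2] at hcost₀
  have e8 : ∑ u ∈ W.erase r, (w u (p u) - ε * (activity q u + activity q (p u))) =
      ∑ u ∈ W.erase r, w u (p u) - ε * ∑ u ∈ W.erase r, activity q u
        - ε * ∑ u ∈ W.erase r, activity q (p u) := by
    simp only [Finset.mul_sum, ← Finset.sum_sub_distrib]
    exact Finset.sum_congr rfl fun a _ => by ring
  have e9 : ∑ a ∈ A \ W, (q a - ε * activity q a) =
      ∑ a ∈ A \ W, q a - ε * ∑ a ∈ A \ W, activity q a := by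
    rw [Finset.sum_sub_distrib, Finset.mul_sum]
  have f3 := mul_le_mul_of_nonneg_left e3 hε
  have f6 := mul_le_mul_of_nonneg_left e6 hε
  rw [e4] at hcost₀
  rw [e8] at e1
  rw [e9] at hcost₀
  linarith

/-- The edge values after merging the vertex `v` into the vertex `u`. -/
def mergeWeight (u v : V) (x : V → V → ℝ) (a b : V) : ℝ :=
  if a = b then 0 else if a = u then x u b + x v b else if b = u then x a u + x a v else x a b

theorem sum_merge_le {u v : V} (hu : u ∈ A) (hv : v ∈ A) (huv : u ≠ v) {w' : V → V → ℝ}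
    (hx0 : ∀ a b, 0 ≤ x a b) (hxd : ∀ a, x a a = 0) (hwuv : 0 ≤ w u v) (hwvu : 0 ≤ w v u)
    (hw : ∀ a ∈ A, ∀ b ∈ A, a ≠ v → b ≠ v → a ≠ b → w' a b ≤ w a b)
    (hw1 : ∀ b ∈ A, b ≠ u → b ≠ v → w' u b ≤ w v b)
    (hw2 : ∀ b ∈ A, b ≠ u → b ≠ v → w' b u ≤ w b v) :
    ∑ a ∈ A.erase v, ∑ b ∈ A.erase v, w' a b * mergeWeight u v x a b ≤
      ∑ a ∈ A, ∑ b ∈ A, w a b * x a b := by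
  obtain ⟨B, huB, hvB, rfl⟩ : ∃ B : Finset V, u ∉ B ∧ v ∉ B ∧ A = insert v (insert u B) := by
    refine ⟨(A.erase v).erase u, by simp, by simp, ?_⟩
    rw [Finset.insert_erase (Finset.mem_erase.2 ⟨huv, hu⟩), Finset.insert_erase hv]
  have hv' : v ∉ insert u B := by simp [hvB, huv.symm]
  rw [Finset.erase_insert hv']
  simp only [Finset.sum_insert hv', Finset.sum_insert huB, Finset.sum_add_distrib]
  have neu : ∀ b ∈ B, b ≠ u := fun b hb h => huB (h ▸ hb)
  have nev : ∀ b ∈ B, b ≠ v := fun b hb h => hvB (h ▸ hb)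
  have memA : ∀ b ∈ B, b ∈ insert v (insert u B) := fun b hb => by simp [hb]
  have k1 : ∑ b ∈ B, w' u b * mergeWeight u v x u b ≤
      ∑ b ∈ B, w u b * x u b + ∑ b ∈ B, w v b * x v b := by
    rw [← Finset.sum_add_distrib]
    refine Finset.sum_le_sum fun b hb => ?_
    have := neu b hb
    simp only [mergeWeight, this.symm, if_false, if_true]
    rw [mul_add]
    exact add_le_add
      (mul_le_mul_of_nonneg_right (hw u hu b (memA b hb) huv (nev b hb) this.symm) (hx0 _ _))
      (mul_le_mul_of_nonneg_right (hw1 b (memA b hb) this (nev b hb)) (hx0 _ _))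
  have k2 : ∑ b ∈ B, w' b u * mergeWeight u v x b u ≤
      ∑ b ∈ B, w b u * x b u + ∑ b ∈ B, w b v * x b v := by
    rw [← Finset.sum_add_distrib]
    refine Finset.sum_le_sum fun b hb => ?_
    have := neu b hb
    simp only [mergeWeight, this, if_false, if_true]
    rw [mul_add]
    exact add_le_add
      (mul_le_mul_of_nonneg_right (hw b (memA b hb) u hu (nev b hb) huv this) (hx0 _ _))
      (mul_le_mul_of_nonneg_right (hw2 b (memA b hb) this (nev b hb)) (hx0 _ _))
  have k3 : ∑ a ∈ B, ∑ b ∈ B, w' a b * mergeWeight u v x a b ≤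
      ∑ a ∈ B, ∑ b ∈ B, w a b * x a b := by
    refine Finset.sum_le_sum fun a ha => Finset.sum_le_sum fun b hb => ?_
    by_cases hab : a = b
    · simp [mergeWeight, hab, hxd]
    · simp only [mergeWeight, hab, neu a ha, neu b hb, if_false]
      exact mul_le_mul_of_nonneg_right
        (hw a (memA a ha) b (memA b hb) (nev a ha) (nev b hb) hab) (hx0 _ _)
  have k4 : mergeWeight u v x u u = 0 := by simp [mergeWeight]
  have k5 := mul_nonneg hwuv (hx0 u v)
  have k6 := mul_nonneg hwvu (hx0 v u)
  rw [k4, hxd u, hxd v]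
  linarith

theorem cut_merge {u v : V} (hu : u ∈ A) (hv : v ∈ A) (huv : u ≠ v) {S : Finset V}
    (hS : S ⊆ A.erase v) :
    ∑ a ∈ S, ∑ b ∈ A.erase v \ S, mergeWeight u v x a b =
      ∑ a ∈ (if u ∈ S then insert v S else S),
        ∑ b ∈ A \ (if u ∈ S then insert v S else S), x a b := by
  have hvS : v ∉ S := fun h => (Finset.mem_erase.1 (hS h)).1 rfl
  split_ifs with huS
  · have e : A \ insert v S = A.erase v \ S := by
      ext b; simp only [Finset.mem_sdiff, Finset.mem_insert, Finset.mem_erase]; tauto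
    rw [e, Finset.sum_insert hvS, ← Finset.add_sum_erase _ _ huS, ← Finset.add_sum_erase _ _ huS,
      ← add_assoc, ← Finset.sum_add_distrib]
    congr 1
    · refine Finset.sum_congr rfl fun b hb => ?_
      have : u ≠ b := fun h => (Finset.mem_sdiff.1 hb).2 (h ▸ huS)
      simp [mergeWeight, this, add_comm]
    · refine Finset.sum_congr rfl fun a ha => Finset.sum_congr rfl fun b hb => ?_
      rw [Finset.mem_erase] at ha
      rw [Finset.mem_sdiff] at hb
      have h1 : a ≠ b := fun h => hb.2 (h ▸ ha.2)
      have h2 : b ≠ u := fun h => hb.2 (h ▸ huS)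
      simp [mergeWeight, h1, h2, ha.1]
  · refine Finset.sum_congr rfl fun a ha => ?_
    have hau : a ≠ u := fun h => huS (h ▸ ha)
    have hu' : u ∈ A.erase v \ S := by simp [hu, huv, huS]
    have e : A \ S = insert v (A.erase v \ S) := by
      ext b; simp only [Finset.mem_sdiff, Finset.mem_insert, Finset.mem_erase]
      by_cases hb : b = v
      · subst hb; tauto
      · tauto
    rw [e, Finset.sum_insert (by simp), ← Finset.add_sum_erase _ _ hu',
      ← Finset.add_sum_erase _ _ hu', ← add_assoc]
    congr 1
    · simp [mergeWeight, hau, add_comm]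
    · refine Finset.sum_congr rfl fun b hb => ?_
      rw [Finset.mem_erase, Finset.mem_sdiff] at hb
      have h1 : a ≠ b := fun h => hb.2.2 (h ▸ ha)
      simp [mergeWeight, h1, hau, hb.1]

theorem mergeWeight_nonneg {u v : V} (hx : ∀ a b, 0 ≤ x a b) (a b : V) :
    0 ≤ mergeWeight u v x a b := by
  unfold mergeWeight
  split_ifs <;> first | exact le_rfl | exact hx _ _ | exact add_nonneg (hx _ _) (hx _ _)

theorem mergeWeight_symm {u v : V} (hx : ∀ a b, x a b = x b a) (a b : V) :
    mergeWeight u v x a b = mergeWeight u v x b a := by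
  unfold mergeWeight
  split_ifs <;> simp_all

theorem mergeWeight_diag (u v : V) (x : V → V → ℝ) (a : V) : mergeWeight u v x a a = 0 := by
  simp [mergeWeight]

theorem IsTreeInstance.mergeSteiner (h : IsTreeInstance r A Z w x q y) {u v : V} (hu : u ∈ A)
    (hv : v ∈ A) (huZ : u ∉ Z) (hvZ : v ∈ Z) :
    IsTreeInstance r (A.erase v) Z w (mergeWeight u v x) q y where
  root_mem := Finset.mem_erase.2 ⟨fun h' => h.root_notMem (h' ▸ hvZ), h.root_mem⟩
  root_notMem := h.root_notMem
  w_nonneg a ha b hb hab := h.w_nonneg a (Finset.mem_of_mem_erase ha) b (Finset.mem_of_mem_erase hb) hab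
  w_symm := h.w_symm
  w_triangle z hz hzZ a ha b hb hab haz hbz := h.w_triangle z (Finset.mem_of_mem_erase hz) hzZ
    a (Finset.mem_of_mem_erase ha) b (Finset.mem_of_mem_erase hb) hab haz hbz
  x_nonneg := mergeWeight_nonneg h.x_nonneg
  x_symm := mergeWeight_symm h.x_symm
  x_diag := mergeWeight_diag u v x
  q_nonneg := h.q_nonneg
  q_root := h.q_root
  q_steiner := h.q_steiner
  q_notMem a ha := by
    by_cases hav : a = v
    · exact h.q_steiner a (hav ▸ hvZ)
    · exact h.q_notMem a fun ha' => ha (Finset.mem_erase.2 ⟨hav, ha'⟩)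
  y_le_one := h.y_le_one
  cut S hS hrS t ht htZ := by
    have huv : u ≠ v := fun e => huZ (e ▸ hvZ)
    have hrv : r ≠ v := fun e => h.root_notMem (e ▸ hvZ)
    rw [cut_merge hu hv huv hS]
    have hSA : S ⊆ A := hS.trans (Finset.erase_subset _ _)
    split_ifs with huS
    · exact h.cut _ (Finset.insert_subset hv hSA) (by simp [hrv, hrS]) t (by simp [ht]) htZ
    · exact h.cut S hSA hrS t ht htZ

theorem IsTreeInstance.hasCheapTree_of_mergeSteiner (h : IsTreeInstance r A Z w x q y) {u v : V}
    (hu : u ∈ A) (hv : v ∈ A) (huZ : u ∉ Z) (hvZ : v ∈ Z) (hw : w u v = 0)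
    (hc : HasCheapTree r (A.erase v) Z w (mergeWeight u v x) q y) :
    HasCheapTree r A Z w x q y := by
  obtain ⟨W, p, hT, hWA, hcost⟩ := hc
  have huv : u ≠ v := fun e => huZ (e ▸ hvZ)
  have hvW : v ∉ W := fun hvW => by simpa using hWA hvW
  refine ⟨W, p, hT, hWA.trans (Finset.sdiff_subset_sdiff (Finset.erase_subset _ _) le_rfl), ?_⟩
  have e0 : w v u = 0 := by rw [h.w_symm, hw]
  have e1 : ∑ a ∈ A, q a * (1 - y a) = ∑ a ∈ A.erase v, q a * (1 - y a) := by
    rw [Finset.sum_erase]; rw [h.q_steiner v hvZ, zero_mul]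
  have e2 : ∑ a ∈ A \ W, q a = ∑ a ∈ A.erase v \ W, q a := by
    rw [Finset.erase_sdiff_comm, Finset.sum_erase]; exact h.q_steiner v hvZ
  have e3 := sum_merge_le (w := w) (w' := w) hu hv huv h.x_nonneg h.x_diag hw.ge e0.ge
    (fun _ _ _ _ _ _ _ => le_rfl)
    (fun b hb hbu hbv => by
      linarith [h.w_triangle v hv hvZ u hu b hb hbu.symm huv hbv])
    (fun b hb hbu hbv => by
      linarith [h.w_triangle v hv hvZ b hb u hu hbu hbv huv])
  rw [e1, e2]
  linarith

/-- Edge lengths after merging the vertex `v` into the vertex `u`. -/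
noncomputable def mergeLength (u v : V) (w : V → V → ℝ) (a b : V) : ℝ :=
  if a = u then min (w u b) (w v b) else if b = u then min (w a u) (w a v) else w a b

/-- The parent map of a tree on the merged vertex set, lifted to the original vertex set. -/
noncomputable def liftParent (r u v : V) (w : V → V → ℝ) (p : V → V) (a : V) : V := by
  classical
  exact
    if a = v then (if u = r ∨ w u (p u) ≤ w v (p u) then u else p u)
    else if a = u then (if u = r ∨ w u (p u) ≤ w v (p u) then p u else v)
    else if p a = u then (if w u a ≤ w v a then u else v)
    else p a

theorem IsRootedTree.liftParent {W : Finset V} {p : V → V} {u v : V} (hT : IsRootedTree r W p)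
    (w : V → V → ℝ) (hu : u ∈ W) (hv : v ∉ W) :
    IsRootedTree r (insert v W) (liftParent r u v w p) := by
  obtain ⟨h1, h2, h3⟩ := hT
  have huv : u ≠ v := fun h => hv (h ▸ hu)
  refine ⟨by simp [h1], fun a ha har => ?_, fun S hS hne => ?_⟩
  · have key : u ≠ r → p u ∈ W := h2 u hu
    have key2 : a ≠ v → p a ∈ W := fun hav =>
      h2 a ((Finset.mem_insert.1 ha).resolve_left hav) har
    unfold _root_.liftParent
    split_ifs <;> simp_all
  · have hSr : r ∉ S := fun h => by simpa using hS h
    by_cases hmeet : u ∈ S ∨ v ∈ S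
    · by_cases hur : u = r
      · have hvS : v ∈ S := hmeet.resolve_left (hur ▸ hSr)
        exact ⟨v, hvS, by simp [_root_.liftParent, hur, hSr]⟩
      · have hS' : insert u (S.erase v) ⊆ W.erase r := by
          intro a ha
          rw [Finset.mem_insert, Finset.mem_erase] at ha
          rcases ha with rfl | ⟨hav, ha⟩
          · simp [hur, hu]
          · have := hS ha
            simp only [Finset.mem_erase, Finset.mem_insert] at this ⊢
            tauto
        obtain ⟨s, hs, hps⟩ := h3 _ hS' ⟨u, by simp⟩
        simp only [Finset.mem_insert, Finset.mem_erase, not_or, not_and] at hs hps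
        by_cases hsu : s = u
        · subst hsu
          have hpW : p s ∈ W := h2 s hu hur
          have hpv : p s ≠ v := fun h => hv (h ▸ hpW)
          have hpS := hps.2 hpv
          by_cases hC : s = r ∨ w s (p s) ≤ w v (p s)
          · by_cases hsS : s ∈ S
            · exact ⟨s, hsS, by simpa [_root_.liftParent, huv, hC] using hpS⟩
            · exact ⟨v, by tauto, by simpa [_root_.liftParent, hC] using hsS⟩
          · by_cases hvS : v ∈ S
            · exact ⟨v, hvS, by simpa [_root_.liftParent, hC] using hpS⟩
            · exact ⟨s, by tauto, by simpa [_root_.liftParent, huv, hC] using hvS⟩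
        · have hs' := hs.resolve_left hsu
          have hsW : s ∈ W := by
            have := hS hs'.2
            simp only [Finset.mem_erase, Finset.mem_insert] at this
            tauto
          have hpW : p s ∈ W := h2 s hsW fun h => hSr (h ▸ hs'.2)
          have hpv : p s ≠ v := fun h => hv (h ▸ hpW)
          exact ⟨s, hs'.2, by simpa [_root_.liftParent, hs'.1, hsu, hps.1] using hps.2 hpv⟩
    · push Not at hmeet
      have hS' : S ⊆ W.erase r := by
        intro a ha
        have := hS ha
        have hav : a ≠ v := fun h => hmeet.2 (h ▸ ha)
        simp only [Finset.mem_erase, Finset.mem_insert] at this ⊢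
        tauto
      obtain ⟨s, hs, hps⟩ := h3 S hS' hne
      have hsv : s ≠ v := fun h => hmeet.2 (h ▸ hs)
      have hsu : s ≠ u := fun h => hmeet.1 (h ▸ hs)
      refine ⟨s, hs, ?_⟩
      simp only [_root_.liftParent, hsv, hsu, if_false]
      split_ifs
      · exact hmeet.1
      · exact hmeet.2
      · exact hps

theorem sum_liftParent_le {W : Finset V} {p : V → V} {u v : V} (hs : ∀ a b, w a b = w b a)
    (hw : w u v = 0) (hu : u ∈ W) (hv : v ∉ W) (hvr : v ≠ r) :
    ∑ a ∈ (insert v W).erase r, w a (liftParent r u v w p a) ≤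
      ∑ a ∈ W.erase r, mergeLength u v w a (p a) := by
  have huv : u ≠ v := fun h => hv (h ▸ hu)
  have hw' : w v u = 0 := by rw [hs, hw]
  rw [Finset.erase_insert_of_ne hvr, Finset.sum_insert (by simp [hv])]
  have key : ∀ a ∈ W, a ≠ u → w a (liftParent r u v w p a) ≤ mergeLength u v w a (p a) := by
    intro a ha hau
    have hav : a ≠ v := fun h => hv (h ▸ ha)
    simp only [liftParent, mergeLength, hau, hav, if_false]
    split_ifs with h1 h2
    · rw [hs a u, hs a v, min_eq_left h2]
    · rw [hs a u, hs a v, min_eq_right (not_le.1 h2).le]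
    · exact le_rfl
  by_cases hur : u = r
  · have : w v (liftParent r u v w p v) = 0 := by simp [liftParent, hur, ← hw']
    rw [this, zero_add]
    refine Finset.sum_le_sum fun a ha => ?_
    rw [Finset.mem_erase] at ha
    exact key a ha.2 (hur ▸ ha.1)
  · have hu' : u ∈ W.erase r := Finset.mem_erase.2 ⟨hur, hu⟩
    rw [← Finset.add_sum_erase _ _ hu', ← Finset.add_sum_erase _ _ hu', ← add_assoc]
    refine add_le_add ?_ (Finset.sum_le_sum fun a ha => ?_)
    · by_cases hC : w u (p u) ≤ w v (p u)
      · simp [liftParent, mergeLength, hC, huv, hw']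
      · simp [liftParent, mergeLength, hC, huv, hw, hur, (not_le.1 hC).le]
    · simp only [Finset.mem_erase] at ha
      exact key a ha.2.2 ha.1

/-- Penalties after merging the vertex `v` into the vertex `u`. -/
def mergePenalty (r u v : V) (q : V → ℝ) (a : V) : ℝ :=
  if a = v then 0 else if a = u then (if u = r then 0 else q u + q v) else q a

theorem sum_mergePenalty {u v : V} {B : Finset V} (hu : u ∈ B) (hv : v ∈ B) (huv : u ≠ v)
    (hur : u ≠ r) : ∑ a ∈ B.erase v, mergePenalty r u v q a = ∑ a ∈ B, q a := by
  have hu' : u ∈ B.erase v := Finset.mem_erase.2 ⟨huv, hu⟩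
  rw [← Finset.add_sum_erase B _ hv, ← Finset.add_sum_erase _ _ hu', ← Finset.add_sum_erase _ q hu']
  have : ∑ a ∈ (B.erase v).erase u, mergePenalty r u v q a = ∑ a ∈ (B.erase v).erase u, q a := by
    refine Finset.sum_congr rfl fun a ha => ?_
    simp only [Finset.mem_erase] at ha
    simp [mergePenalty, ha.1, ha.2.1]
  rw [this]
  simp only [mergePenalty, huv, hur, if_false, if_true]
  ring

theorem IsTreeInstance.merge (h : IsTreeInstance r A Z w x q y) {u v : V} (hu : u ∈ A)
    (hv : v ∈ A) (huv : u ≠ v) (huZ : u ∉ Z) (hvZ : v ∉ Z) (hvr : v ≠ r) :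
    IsTreeInstance r (A.erase v) Z (mergeLength u v w) (mergeWeight u v x) (mergePenalty r u v q)
      (fun a => if a = u then max (y u) (y v) else y a) where
  root_mem := Finset.mem_erase.2 ⟨hvr.symm, h.root_mem⟩
  root_notMem := h.root_notMem
  w_nonneg a ha b hb hab := by
    rw [Finset.mem_erase] at ha hb
    unfold mergeLength
    split_ifs with h1 h2
    · exact le_min (h.w_nonneg u hu b hb.2 (h1 ▸ hab)) (h.w_nonneg v hv b hb.2 hb.1.symm)
    · exact le_min (h.w_nonneg a ha.2 u hu h1) (h.w_nonneg a ha.2 v hv ha.1)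
    · exact h.w_nonneg a ha.2 b hb.2 hab
  w_symm a b := by
    unfold mergeLength
    split_ifs with h1 h2
    · rw [h1, h2]
    · rw [h.w_symm u b, h.w_symm v b]
    · rw [h.w_symm a u, h.w_symm a v]
    · exact h.w_symm a b
  w_triangle z hz hzZ a ha b hb hab haz hbz := by
    rw [Finset.mem_erase] at ha hb hz
    have hzu : z ≠ u := fun h => huZ (h ▸ hzZ)
    by_cases hau : a = u
    · subst hau
      simp only [mergeLength, hzu, hab.symm, if_true, if_false]
      rcases min_choice (w a z) (w v z) with e | e <;> rw [e]
      · exact (min_le_left _ _).trans (h.w_triangle z hz.2 hzZ a hu b hb.2 hab haz hbz)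
      · exact (min_le_right _ _).trans (h.w_triangle z hz.2 hzZ v hv b hb.2 hb.1.symm hz.1.symm hbz)
    · by_cases hbu : b = u
      · subst hbu
        simp only [mergeLength, hzu, hab, if_true, if_false]
        rcases min_choice (w z b) (w z v) with e | e <;> rw [e]
        · exact (min_le_left _ _).trans (h.w_triangle z hz.2 hzZ a ha.2 b hu hab haz hbz)
        · exact (min_le_right _ _).trans (h.w_triangle z hz.2 hzZ a ha.2 v hv ha.1 haz hz.1.symm)
      · simp only [mergeLength, hau, hbu, hzu, if_false]
        exact h.w_triangle z hz.2 hzZ a ha.2 b hb.2 hab haz hbz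
  x_nonneg := mergeWeight_nonneg h.x_nonneg
  x_symm := mergeWeight_symm h.x_symm
  x_diag := mergeWeight_diag u v x
  q_nonneg a := by
    have := h.q_nonneg u
    have := h.q_nonneg v
    unfold mergePenalty
    split_ifs <;> first | exact le_rfl | positivity | exact h.q_nonneg a
  q_root := by
    unfold mergePenalty
    split_ifs with h1 h2 h3
    · rfl
    · rfl
    · exact absurd h2.symm h3
    · exact h.q_root
  q_steiner z hz := by
    have h1 : z ≠ u := fun h => huZ (h ▸ hz)
    have h2 : z ≠ v := fun h => hvZ (h ▸ hz)
    simp [mergePenalty, h1, h2, h.q_steiner z hz]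
  q_notMem a ha := by
    by_cases hav : a = v
    · simp [mergePenalty, hav]
    · have haA : a ∉ A := fun h => ha (Finset.mem_erase.2 ⟨hav, h⟩)
      have hau : a ≠ u := fun h => haA (h ▸ hu)
      simp [mergePenalty, hav, hau, h.q_notMem a haA]
  y_le_one a := by
    split_ifs
    · exact max_le (h.y_le_one u) (h.y_le_one v)
    · exact h.y_le_one a
  cut S hS hrS t ht htZ := by
    rw [cut_merge hu hv huv hS]
    have hSA : S ⊆ A := hS.trans (Finset.erase_subset _ _)
    split_ifs with htu huS huS
    · have hi := Finset.insert_subset hv hSA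
      have hr : r ∉ insert v S := by simp [hvr.symm, hrS]
      have c1 := h.cut _ hi hr u (by simp [huS]) huZ
      have c2 := h.cut _ hi hr v (by simp) hvZ
      rcases max_choice (y u) (y v) with e | e <;> rw [e] <;> assumption
    · exact absurd (htu ▸ ht) huS
    · exact h.cut _ (Finset.insert_subset hv hSA) (by simp [hvr.symm, hrS]) t (by simp [ht]) htZ
    · exact h.cut S hSA hrS t ht htZ

theorem IsTreeInstance.hasCheapTree_of_merge (h : IsTreeInstance r A Z w x q y) {u v : V}
    (hu : u ∈ A) (hv : v ∈ A) (huv : u ≠ v) (hvZ : v ∉ Z) (hvr : v ≠ r)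
    (hw : w u v = 0)
    (hc : HasCheapTree r (A.erase v) Z (mergeLength u v w) (mergeWeight u v x)
      (mergePenalty r u v q) (fun a => if a = u then max (y u) (y v) else y a)) :
    HasCheapTree r A Z w x q y := by
  obtain ⟨W, p, hT, hWA, hcost⟩ := hc
  have hvW : v ∉ W := fun hvW => by simpa using hWA hvW
  have hw' : w v u = 0 := by rw [h.w_symm, hw]
  have e1 := sum_merge_le (w := w) (w' := mergeLength u v w) hu hv huv h.x_nonneg h.x_diag
    hw.ge hw'.ge
    (fun a _ b _ _ _ _ => by
      unfold mergeLength
      split_ifs with h1 h2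
      · rw [h1]; exact min_le_left _ _
      · rw [h2]; exact min_le_left _ _
      · exact le_rfl)
    (fun b _ _ _ => by simp [mergeLength])
    (fun b _ hbu _ => by simp [mergeLength, hbu])
  have e2 : ∑ a ∈ A.erase v, mergePenalty r u v q a * (1 - if a = u then max (y u) (y v) else y a) ≤
      ∑ a ∈ A, q a * (1 - y a) := by
    have hu' : u ∈ A.erase v := Finset.mem_erase.2 ⟨huv, hu⟩
    rw [← Finset.add_sum_erase A _ hv, ← Finset.add_sum_erase _ _ hu',
      ← Finset.add_sum_erase _ (fun a => q a * (1 - y a)) hu']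
    have : ∑ a ∈ (A.erase v).erase u,
        mergePenalty r u v q a * (1 - if a = u then max (y u) (y v) else y a) =
        ∑ a ∈ (A.erase v).erase u, q a * (1 - y a) := by
      refine Finset.sum_congr rfl fun a ha => ?_
      simp only [Finset.mem_erase] at ha
      simp [mergePenalty, ha.1, ha.2.1]
    rw [this]
    have n1 := mul_nonneg (h.q_nonneg v) (sub_nonneg.2 (h.y_le_one v))
    have n2 := mul_nonneg (h.q_nonneg u) (sub_nonneg.2 (h.y_le_one u))
    simp only [mergePenalty, huv, if_true, if_false]
    split_ifs
    · linarith
    · have n3 := mul_le_mul_of_nonneg_left (le_max_left (y u) (y v)) (h.q_nonneg u)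
      have n4 := mul_le_mul_of_nonneg_left (le_max_right (y u) (y v)) (h.q_nonneg v)
      linarith
  by_cases huW : u ∈ W
  · refine ⟨insert v W, liftParent r u v w p, hT.liftParent w huW hvW, ?_, ?_⟩
    · refine Finset.insert_subset (by simp [hv, hvZ])
        (hWA.trans (Finset.sdiff_subset_sdiff (Finset.erase_subset _ _) le_rfl))
    · have e3 : ∑ a ∈ A \ insert v W, q a = ∑ a ∈ A.erase v \ W, mergePenalty r u v q a := by
        have : A \ insert v W = A.erase v \ W := by
          ext b; simp only [Finset.mem_sdiff, Finset.mem_insert, Finset.mem_erase]; tauto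
        rw [this]
        refine Finset.sum_congr rfl fun a ha => ?_
        rw [Finset.mem_sdiff, Finset.mem_erase] at ha
        have : a ≠ u := fun h => ha.2 (h ▸ huW)
        simp [mergePenalty, ha.1.1, this]
      have e4 := sum_liftParent_le (r := r) (p := p) h.w_symm hw huW hvW hvr
      linarith
  · have hur : u ≠ r := fun h => huW (h ▸ hT.1)
    refine ⟨W, p, hT, hWA.trans (Finset.sdiff_subset_sdiff (Finset.erase_subset _ _) le_rfl), ?_⟩
    have e3 : ∑ a ∈ A \ W, q a = ∑ a ∈ A.erase v \ W, mergePenalty r u v q a := by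
      rw [Finset.erase_sdiff_comm, sum_mergePenalty (by simp [hu, huW]) (by simp [hv, hvW]) huv hur]
    have e4 : ∑ a ∈ W.erase r, w a (p a) = ∑ a ∈ W.erase r, mergeLength u v w a (p a) := by
      refine Finset.sum_congr rfl fun a ha => ?_
      rw [Finset.mem_erase] at ha
      have h1 : a ≠ u := fun h => huW (h ▸ ha.2)
      have h2 : p a ≠ u := fun h => huW (h ▸ hT.2.1 a ha.2 ha.1)
      simp [mergeLength, h1, h2]
    rw [e3, e4]
    linarith

/-- A Lagrangian-multiplier-preserving tree exists (the Goemans–Williamson primal-dual argument,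
phrased as an induction on contractions and deactivations). -/
theorem IsTreeInstance.hasCheapTree (n : ℕ) : ∀ {A : Finset V} {w x : V → V → ℝ} {q y : V → ℝ},
    IsTreeInstance r A Z w x q y → 2 * A.card + (A.filter (fun a => 0 < q a)).card < n →
    HasCheapTree r A Z w x q y := by
  classical
  induction n with
  | zero => intro A w x q y _ h; exact absurd h (Nat.not_lt_zero _)
  | succ n ih =>
    intro A w x q y h hn
    by_cases hact : ∃ a ∈ A, 0 < q a
    · obtain ⟨a₀, ha₀, hqa₀⟩ := hact
      set Act := A.filter (fun a => 0 < q a) with hAct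
      set P := (A ×ˢ A).filter (fun e => e.1 ≠ e.2 ∧ 0 < q e.1) with hP
      obtain ⟨a₁, ha₁, hmin₁⟩ := Finset.exists_min_image Act q ⟨a₀, by simp [hAct, ha₀, hqa₀]⟩
      have hra₀ : r ≠ a₀ := fun e => by rw [← e, h.q_root] at hqa₀; exact lt_irrefl _ hqa₀
      obtain ⟨e₁, he₁, hmin₂⟩ := Finset.exists_min_image P
        (fun e => w e.1 e.2 / (activity q e.1 + activity q e.2))
        ⟨(a₀, r), by simp [hP, ha₀, h.root_mem, hra₀.symm, hqa₀]⟩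
      simp only [hAct, Finset.mem_filter] at ha₁
      simp only [hP, Finset.mem_filter, Finset.mem_product] at he₁
      set ε₂ := w e₁.1 e₁.2 / (activity q e₁.1 + activity q e₁.2) with hε₂
      have hpos : ∀ a b, 0 < q a → 0 < activity q a + activity q b := fun a b ha => by
        rw [activity_of_pos ha]; linarith [(activity_mem q b).1]
      have hε₂0 : 0 ≤ ε₂ :=
        div_nonneg (h.w_nonneg _ he₁.1.1 _ he₁.1.2 he₁.2.1) (hpos _ _ he₁.2.2).le
      have hε : 0 ≤ min (q a₁) ε₂ := le_min (h.q_nonneg _) hε₂0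
      have hg := h.grow (ε := min (q a₁) ε₂)
        (fun a ha hqa => (min_le_left _ _).trans (hmin₁ a (by simp [hAct, ha, hqa])))
        (fun a ha b hb hab => by
          by_cases hqa : 0 < q a
          · have := (min_le_right (q a₁) ε₂).trans (hmin₂ (a, b) (by simp [hP, ha, hb, hab, hqa]))
            exact (le_div_iff₀ (hpos _ _ hqa)).1 this
          · by_cases hqb : 0 < q b
            · have := (min_le_right (q a₁) ε₂).trans
                (hmin₂ (b, a) (by simp [hP, ha, hb, hab.symm, hqb]))
              rw [h.w_symm, add_comm]
              exact (le_div_iff₀ (hpos _ _ hqb)).1 this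
            · have h1 := activity_of_eq_zero (le_antisymm (not_lt.1 hqa) (h.q_nonneg a))
              have h2 := activity_of_eq_zero (le_antisymm (not_lt.1 hqb) (h.q_nonneg b))
              rw [h1, h2]
              simpa using h.w_nonneg a ha b hb hab)
      refine h.hasCheapTree_of_grow hε hg ?_
      generalize hε' : min (q a₁) ε₂ = ε at *
      have hsub : ∀ a, 0 < q a - ε * activity q a → 0 < q a := fun a ha => by
        have := mul_nonneg hε (activity_mem q a).1
        linarith
      rcases min_choice (q a₁) ε₂ with hm | hm
      · refine ih hg (lt_of_lt_of_le ?_ (Nat.lt_succ_iff.1 hn))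
        refine Nat.add_lt_add_left (Finset.card_lt_card ?_) _
        refine ⟨fun a ha => ?_, fun hss => ?_⟩
        · simp only [hAct, Finset.mem_filter] at ha ⊢
          exact ⟨ha.1, hsub a ha.2⟩
        · have := hss (show a₁ ∈ Act by simp [hAct, ha₁])
          simp only [Finset.mem_filter, activity_of_pos ha₁.2, ← hε', hm] at this
          linarith [this.2]
      · obtain ⟨⟨h1A, h2A⟩, hne, hq1⟩ := he₁
        have hw0 : w e₁.1 e₁.2 - ε * (activity q e₁.1 + activity q e₁.2) = 0 := by
          rw [← hε', hm, hε₂, div_mul_cancel₀ _ (hpos _ _ hq1).ne']; ring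
        have h1r : e₁.1 ≠ r := fun e => by rw [e, h.q_root] at hq1; exact lt_irrefl _ hq1
        have h1Z : e₁.1 ∉ Z := fun e => by rw [h.q_steiner _ e] at hq1; exact lt_irrefl _ hq1
        have hfil : (A.filter (fun a => 0 < q a - ε * activity q a)).card ≤ Act.card :=
          Finset.card_le_card fun a ha => by
            simp only [hAct, Finset.mem_filter] at ha ⊢
            exact ⟨ha.1, hsub a ha.2⟩
        by_cases h2Z : e₁.2 ∈ Z
        · refine hg.hasCheapTree_of_mergeSteiner h1A h2A h1Z h2Z hw0
            (ih (hg.mergeSteiner h1A h2A h1Z h2Z) ?_)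
          have c1 := Finset.card_erase_add_one h2A
          have c2 := Finset.card_le_card
            (Finset.filter_subset_filter (fun a => 0 < q a - ε * activity q a)
              (Finset.erase_subset e₁.2 A))
          omega
        · refine hg.hasCheapTree_of_merge h2A h1A hne.symm h1Z h1r ?_
            (ih (hg.merge h2A h1A hne.symm h2Z h1Z h1r) ?_)
          · rw [hg.w_symm]; exact hw0
          · have c1 := Finset.card_erase_add_one h1A
            have c2 : ((A.erase e₁.1).filter
                (fun a => 0 < mergePenalty r e₁.2 e₁.1 (fun a => q a - ε * activity q a) a)).card ≤
                (insert e₁.2 (A.filter (fun a => 0 < q a - ε * activity q a))).card := by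
              refine Finset.card_le_card fun a ha => ?_
              simp only [Finset.mem_filter, Finset.mem_erase, Finset.mem_insert] at ha ⊢
              by_cases ha2 : a = e₁.2
              · exact Or.inl ha2
              · refine Or.inr ⟨ha.1.2, ?_⟩
                simpa [mergePenalty, ha2, ha.1.1] using ha.2
            have c3 := Finset.card_insert_le e₁.2 (A.filter (fun a => 0 < q a - ε * activity q a))
            omega
    · push Not at hact
      have hq : ∀ a ∈ A, q a = 0 := fun a ha => le_antisymm (hact a ha) (h.q_nonneg a)
      refine ⟨{r}, id, ⟨by simp, fun u hu hur => absurd (by simpa using hu) hur, ?_⟩, ?_, ?_⟩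
      · intro S hS hne
        obtain ⟨s, hs⟩ := hne
        exact absurd (hS hs) (by simp)
      · simp [h.root_mem, h.root_notMem]
      · have e1 : ∑ a ∈ A \ {r}, q a = 0 :=
          Finset.sum_eq_zero fun a ha => hq a (Finset.mem_sdiff.1 ha).1
        have e2 : ∑ a ∈ A, q a * (1 - y a) = 0 :=
          Finset.sum_eq_zero fun a ha => by rw [hq a ha, zero_mul]
        have e3 : 0 ≤ ∑ a ∈ A, ∑ b ∈ A, w a b * x a b := by
          refine Finset.sum_nonneg fun a ha => Finset.sum_nonneg fun b hb => ?_
          by_cases hab : a = b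
          · rw [hab, h.x_diag, mul_zero]
          · exact mul_nonneg (h.w_nonneg a ha b hb hab) (h.x_nonneg a b)
        rw [e1, e2]
        simp
        linarith

end

section
variable {V : Type*} [DecidableEq V] {r : V} {W : Finset V} {p : V → V} {y η : V → ℝ}

/-- `η u` is the maximum of `y` over the subtree below `u`. -/
structure IsSubtreeMax (r : V) (W : Finset V) (p : V → V) (y η : V → ℝ) : Prop where
  le : ∀ u ∈ W, y u ≤ η u
  mono : ∀ u ∈ W, u ≠ r → η u ≤ η (p u)
  attained : ∀ u ∈ W, u ≠ r → η u = y u ∨ ∃ b ∈ W, b ≠ r ∧ p b = u ∧ η b = η u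
  exists_eq : ∀ u ∈ W, ∃ w ∈ W, η u = y w

theorem IsRootedTree.exists_isSubtreeMax (hT : IsRootedTree r W p) (y : V → ℝ) :
    ∃ η, IsSubtreeMax r W p y η := by
  classical
  let R := Relation.ReflTransGen (fun a b => a ∈ W ∧ a ≠ r ∧ p a = b)
  have hmax : ∀ u, ∃ m, u ∈ W → m ∈ W ∧ R m u ∧ ∀ w ∈ W, R w u → y w ≤ y m := by
    intro u
    by_cases hu : u ∈ W
    · obtain ⟨m, hm, hmax⟩ := Finset.exists_max_image (W.filter (fun w => R w u)) y
        ⟨u, Finset.mem_filter.2 ⟨hu, Relation.ReflTransGen.refl⟩⟩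
      rw [Finset.mem_filter] at hm
      exact ⟨m, fun _ => ⟨hm.1, hm.2, fun w hw hwu => hmax w (Finset.mem_filter.2 ⟨hw, hwu⟩)⟩⟩
    · exact ⟨u, fun h => absurd h hu⟩
  choose m hm using hmax
  have hmono : ∀ u ∈ W, u ≠ r → y (m u) ≤ y (m (p u)) := fun u hu hur => by
    obtain ⟨h1, h2, -⟩ := hm u hu
    exact (hm (p u) (hT.2.1 u hu hur)).2.2 _ h1 (h2.tail ⟨hu, hur, rfl⟩)
  refine ⟨fun u => y (m u), fun u hu => (hm u hu).2.2 u hu Relation.ReflTransGen.refl, hmono,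
    fun u hu hur => ?_, fun u hu => ⟨m u, (hm u hu).1, rfl⟩⟩
  obtain ⟨h1, h2, -⟩ := hm u hu
  rcases Relation.ReflTransGen.cases_tail h2 with h | ⟨b, hb, hbW, hbr, hpb⟩
  · exact Or.inl (by rw [← h])
  · refine Or.inr ⟨b, hbW, hbr, hpb, le_antisymm ?_ ((hm b hbW).2.2 _ h1 hb)⟩
    exact hpb ▸ hmono b hbW hbr

theorem IsRootedTree.filter (hT : IsRootedTree r W p) {P : V → Prop} [DecidablePred P] (hr : P r)
    (hp : ∀ u ∈ W, u ≠ r → P u → P (p u)) : IsRootedTree r (W.filter P) p := by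
  refine ⟨Finset.mem_filter.2 ⟨hT.1, hr⟩, fun u hu hur => ?_, fun S hS hne =>
    hT.2.2 S (hS.trans (Finset.erase_subset_erase _ (Finset.filter_subset _ _))) hne⟩
  rw [Finset.mem_filter] at hu ⊢
  exact ⟨hT.2.1 u hu.1 hur, hp u hu.1 hur hu.2⟩

/-- The non-root vertices of `K` whose parent edge crosses `S`. -/
def treeCut (r : V) (K : Finset V) (p : V → V) (S : Finset V) : Finset V :=
  (K.erase r).filter (fun u => ¬(u ∈ S ↔ p u ∈ S))

theorem IsRootedTree.exists_eq_of_treeCut_eq_singleton {K S : Finset V} {u : V}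
    (hT : IsRootedTree r W p) (hη : IsSubtreeMax r W p y η) (hK : IsRootedTree r K p)
    (hKW : K ⊆ W) (hKη : ∀ a ∈ W, ∀ b ∈ K, η a = η b → a ∈ K) (hrS : r ∉ S)
    (hu : treeCut r K p S = {u}) : ∃ w ∈ W, w ∈ S ∧ y w = η u := by
  have huC : u ∈ treeCut r K p S := by simp [hu]
  have hcross : ∀ a ∈ K, a ≠ r → ¬(a ∈ S ↔ p a ∈ S) → a = u := fun a ha har h => by
    have : a ∈ treeCut r K p S :=
      Finset.mem_filter.2 ⟨Finset.mem_erase.2 ⟨har, ha⟩, h⟩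
    simpa [hu] using this
  have hSr : ∀ a ∈ S, a ≠ r := fun a ha h => hrS (h ▸ ha)
  simp only [treeCut, Finset.mem_filter, Finset.mem_erase] at huC
  obtain ⟨⟨hur, huK⟩, huS⟩ := huC
  have huS' : u ∈ S := by
    have hpK := hK.2.1 u huK hur
    obtain ⟨s, hs, hps⟩ := hK.2.2 (S ∩ K) (fun a ha => by
        rw [Finset.mem_inter] at ha
        exact Finset.mem_erase.2 ⟨hSr a ha.1, ha.2⟩) (by
      by_cases h : u ∈ S
      · exact ⟨u, by simp [h, huK]⟩
      · exact ⟨p u, by simp only [Finset.mem_inter]; tauto⟩)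
    rw [Finset.mem_inter] at hs hps
    have hpsK := hK.2.1 s hs.2 (hSr s hs.1)
    have := hcross s hs.2 (hSr s hs.1) (by tauto)
    exact this ▸ hs.1
  by_contra! hno
  set B := (W ∩ S).filter (fun a => η a = η u) with hB
  have hBsub : B ⊆ W.erase r := fun a ha => by
    simp only [hB, Finset.mem_filter, Finset.mem_inter] at ha
    exact Finset.mem_erase.2 ⟨hSr a ha.1.2, ha.1.1⟩
  have hBim : B ⊆ B.image p := fun a ha => by
    simp only [hB, Finset.mem_filter, Finset.mem_inter] at ha
    obtain ⟨⟨haW, haS⟩, haη⟩ := ha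
    rcases hη.attained a haW (hSr a haS) with h | ⟨b, hbW, hbr, hpb, hb⟩
    · exact absurd (h ▸ haη) (hno a haW haS)
    · have hbK := hKη b hbW u huK (hb.trans haη)
      refine Finset.mem_image.2 ⟨b, ?_, hpb⟩
      simp only [hB, Finset.mem_filter, Finset.mem_inter]
      refine ⟨⟨hbW, ?_⟩, hb.trans haη⟩
      by_contra hbS
      have := hcross b hbK hbr (by rw [hpb]; tauto)
      exact hbS (this ▸ huS')
  have hBeq := Finset.eq_of_subset_of_card_le hBim Finset.card_image_le
  obtain ⟨s, hs, hps⟩ := hT.2.2 B hBsub ⟨u, by simp [hB, huS', hKW huK]⟩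
  exact hps (hBeq ▸ Finset.mem_image_of_mem p hs)

theorem one_le_of_odd_treeCut {K S : Finset V} {β δ d : ℝ}
    (hT : IsRootedTree r W p) (hη : IsSubtreeMax r W p y η) (hK : IsRootedTree r K p)
    (hKW : K ⊆ W) (hKη : ∀ a ∈ W, ∀ b ∈ K, η a = η b → a ∈ K) (hrS : r ∉ S)
    (hβ0 : 0 ≤ β) (hβ : β * (3 - δ) = 1) (hβ2 : 2 * β ≤ 1) (hδ : ∀ v ∈ W, δ ≤ y v)
    (hy : ∀ v ∈ W, y v ≤ 1) (hd : ∀ v ∈ W, v ∈ S → 2 * y v ≤ d)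
    (hodd : Odd (treeCut r K p S).card) :
    1 ≤ β * d + ∑ u ∈ treeCut r K p S, (1 - 2 * β * η u) := by
  have hη1 : ∀ u ∈ W, η u ≤ 1 := fun u hu => by
    obtain ⟨w, hw, h⟩ := hη.exists_eq u hu
    exact h ▸ hy w hw
  by_cases h1 : (treeCut r K p S).card = 1
  · obtain ⟨u, hu⟩ := Finset.card_eq_one.1 h1
    obtain ⟨w, hw, hwS, hwu⟩ := hT.exists_eq_of_treeCut_eq_singleton hη hK hKW hKη hrS hu
    rw [hu, Finset.sum_singleton, ← hwu]
    nlinarith [hd w hw hwS]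
  · have h3 : 3 ≤ (treeCut r K p S).card := by
      obtain ⟨k, hk⟩ := hodd
      omega
    have hmem : ∀ u ∈ treeCut r K p S, u ∈ K ∧ u ≠ r ∧ ¬(u ∈ S ↔ p u ∈ S) := fun u hu => by
      simp only [treeCut, Finset.mem_filter, Finset.mem_erase] at hu
      tauto
    have hsum : (treeCut r K p S).card • (1 - 2 * β) ≤
        ∑ u ∈ treeCut r K p S, (1 - 2 * β * η u) := by
      refine Finset.card_nsmul_le_sum _ _ _ fun u hu => ?_
      nlinarith [hη1 u (hKW (hmem u hu).1)]
    rw [nsmul_eq_mul] at hsum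
    have h3' : (3 : ℝ) ≤ (treeCut r K p S).card := by exact_mod_cast h3
    obtain ⟨u, hu⟩ := Finset.card_pos.1 (lt_of_lt_of_le (by norm_num) h3)
    obtain ⟨huK, hur, huS⟩ := hmem u hu
    have hδd : 2 * δ ≤ d := by
      by_cases h : u ∈ S
      · linarith [hd u (hKW huK) h, hδ u (hKW huK)]
      · have hpK := hKW (hK.2.1 u huK hur)
        have hpS : p u ∈ S := by tauto
        linarith [hd _ hpK hpS, hδ _ hpK]
    nlinarith

end

section
variable {E V : Type*} [DecidableEq V]

theorem add_self_eq_zero_of_zmod_two {ι : Type*} (f : ι → ZMod 2) : f + f = 0 :=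
  funext fun x => CharTwo.add_self_eq_zero (f x)

/-- The boundary modulo two of a set of edges in the multigraph with end maps `s` and `t`. -/
def joinBoundary (s t : E → V) (J : Finset E) : V → ZMod 2 :=
  ∑ e ∈ J, (Pi.single (s e) 1 + Pi.single (t e) 1)

/-- The non-loop edges of a multigraph incident to `b`. -/
def vertexStar [Fintype E] (s t : E → V) (b : V) : Finset E :=
  Finset.univ.filter (fun e => s e ≠ t e ∧ (s e = b ∨ t e = b))

variable {s t : E → V} {J K : Finset E} {c : E → ℝ}

theorem joinBoundary_singleton (s t : E → V) (e : E) :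
    joinBoundary s t {e} = Pi.single (s e) 1 + Pi.single (t e) 1 := by simp [joinBoundary]

theorem mem_vertexStar [Fintype E] {b : V} {e : E} :
    e ∈ vertexStar s t b ↔ s e ≠ t e ∧ (s e = b ∨ t e = b) := by simp [vertexStar]

theorem exists_joinBoundary_singleton_of_mem_vertexStar [Fintype E] {b : V} {e : E} (h : e ∈ vertexStar s t b) :
    ∃ a, joinBoundary s t {e} = Pi.single b 1 + Pi.single a 1 := by
  rcases mem_vertexStar.1 h with ⟨-, rfl | rfl⟩
  · exact ⟨t e, joinBoundary_singleton s t e⟩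
  · exact ⟨s e, by rw [joinBoundary_singleton, add_comm]⟩

theorem joinBoundary_apply_eq_zero [Fintype E] {b : V} (h : ∀ e ∈ J, e ∉ vertexStar s t b) :
    joinBoundary s t J b = 0 := by
  rw [joinBoundary, Finset.sum_apply]
  refine Finset.sum_eq_zero fun e he => ?_
  have := h e he
  rw [mem_vertexStar] at this
  by_cases hst : s e = t e
  · rw [hst, add_self_eq_zero_of_zmod_two, Pi.zero_apply]
  · have h1 : b ≠ s e := fun h => this ⟨hst, Or.inl h.symm⟩
    have h2 : b ≠ t e := fun h => this ⟨hst, Or.inr h.symm⟩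
    simp [h1, h2]

theorem sum_joinBoundary (S : Finset V) :
    ∑ x ∈ S, joinBoundary s t J x = ((J.filter (fun e => ¬(s e ∈ S ↔ t e ∈ S))).card : ZMod 2) := by
  simp only [joinBoundary, Finset.sum_apply]
  rw [Finset.sum_comm, Finset.card_filter]
  push_cast
  refine Finset.sum_congr rfl fun e _ => ?_
  simp only [Pi.add_apply, Finset.sum_add_distrib]
  by_cases h1 : s e ∈ S <;> by_cases h2 : t e ∈ S <;> simp [h1, h2]
  decide

theorem joinBoundary_comp [Fintype V] (φ : V → V) (J : Finset E) (x : V) :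
    joinBoundary (φ ∘ s) (φ ∘ t) J x = ∑ a with φ a = x, joinBoundary s t J a := by
  have key : ∀ v, (Pi.single (φ v) 1 : V → ZMod 2) x =
      ∑ a with φ a = x, (Pi.single v 1 : V → ZMod 2) a := fun v => by
    simp only [Pi.single_apply]
    rw [Finset.sum_ite_eq']
    simp [eq_comm]
  simp only [joinBoundary, Finset.sum_apply, Pi.add_apply, Function.comp_apply]
  rw [Finset.sum_comm]
  refine Finset.sum_congr rfl fun e _ => ?_
  rw [Finset.sum_add_distrib, key, key]

variable [DecidableEq E]

theorem joinBoundary_symmDiff (s t : E → V) (J K : Finset E) :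
    joinBoundary s t (symmDiff J K) = joinBoundary s t J + joinBoundary s t K := by
  unfold joinBoundary
  rw [← Finset.sum_inter_add_sum_sdiff J K, ← Finset.sum_inter_add_sum_sdiff K J,
    Finset.inter_comm K J, symmDiff, Finset.sup_eq_union, Finset.sum_union disjoint_sdiff_sdiff]
  linear_combination -add_self_eq_zero_of_zmod_two
    (∑ e ∈ J ∩ K, (Pi.single (s e) (1 : ZMod 2) + Pi.single (t e) 1))

theorem joinBoundary_sdiff (h : K ⊆ J) :
    joinBoundary s t (J \ K) = joinBoundary s t J + joinBoundary s t K := by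
  rw [← joinBoundary_symmDiff, symmDiff_of_ge h]

theorem joinBoundary_erase {e : E} (h : e ∈ J) :
    joinBoundary s t (J.erase e) = joinBoundary s t J + joinBoundary s t {e} := by
  rw [← joinBoundary_sdiff (by simpa using h), Finset.erase_eq]

theorem joinBoundary_insert {e : E} (h : e ∉ J) :
    joinBoundary s t (insert e J) = joinBoundary s t J + joinBoundary s t {e} := by
  simp only [joinBoundary, Finset.sum_insert h, Finset.sum_singleton]
  ring

theorem sum_symmDiff_add_sum_symmDiff {R : Finset E} (c : E → ℝ) (h : R ⊆ symmDiff J K) :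
    ∑ e ∈ symmDiff J R, c e + ∑ e ∈ symmDiff K R, c e = ∑ e ∈ J, c e + ∑ e ∈ K, c e := by
  have key : ∀ A B : Finset E, ∑ e ∈ symmDiff A B, c e =
      ∑ e ∈ A, c e + ∑ e ∈ B, c e - 2 * ∑ e ∈ A ∩ B, c e := by
    intro A B
    rw [← Finset.sum_inter_add_sum_sdiff A B, ← Finset.sum_inter_add_sum_sdiff B A,
      Finset.inter_comm B A, symmDiff, Finset.sup_eq_union, Finset.sum_union disjoint_sdiff_sdiff]
    ring
  have h2 : ∑ e ∈ R, c e = ∑ e ∈ J ∩ R, c e + ∑ e ∈ K ∩ R, c e := by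
    rw [← Finset.sum_union]
    · congr 1
      ext e
      have := @h e
      simp only [Finset.mem_symmDiff, Finset.mem_union, Finset.mem_inter] at this ⊢
      tauto
    · rw [Finset.disjoint_left]
      intro e h1 h2
      rw [Finset.mem_inter] at h1 h2
      have := h h1.2
      rw [Finset.mem_symmDiff] at this
      tauto
  rw [key, key, h2]
  ring

theorem exists_mem_vertexStar_connecting [Fintype E] {X : Finset E} {a b : V} (hab : a ≠ b)
    (hX : joinBoundary s t X = Pi.single a 1 + Pi.single b 1) :
    ∃ e ∈ X, e ∈ vertexStar s t b ∧ ∃ P ⊆ X, joinBoundary s t P = Pi.single a 1 + Pi.single b 1 ∧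
      ∀ f ∈ P, f ∈ vertexStar s t b → f = e := by
  classical
  set X' := X.filter (· ∉ vertexStar s t b) with hX'
  let good : Finset E → Prop := fun Q => ∃ w, joinBoundary s t Q = Pi.single a 1 + Pi.single w 1
  obtain ⟨Q, hQ, hmax⟩ := Finset.exists_max_image (X'.powerset.filter good) Finset.card
    ⟨∅, by
      simp only [good, Finset.mem_filter, Finset.empty_mem_powerset, true_and]
      exact ⟨a, by rw [add_self_eq_zero_of_zmod_two]; simp [joinBoundary]⟩⟩
  simp only [good, Finset.mem_filter, Finset.mem_powerset] at hQ hmax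
  obtain ⟨hQX, w, hw⟩ := hQ
  have hQb : ∀ e ∈ Q, e ∉ vertexStar s t b := fun e he => (Finset.mem_filter.1 (hQX he)).2
  have hwb : w ≠ b := fun h => by
    have h0 := joinBoundary_apply_eq_zero hQb
    rw [hw, h] at h0
    simp [hab.symm] at h0
  have hno : ∀ e ∈ X' \ Q, e ∉ vertexStar s t w := fun e he hew => by
    rw [Finset.mem_sdiff] at he
    obtain ⟨v, hv⟩ := exists_joinBoundary_singleton_of_mem_vertexStar hew
    have := hmax (insert e Q) ⟨Finset.insert_subset he.1 hQX, v, by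
      rw [joinBoundary_insert he.2, hw, hv]
      linear_combination add_self_eq_zero_of_zmod_two (Pi.single w 1)⟩
    rw [Finset.card_insert_of_notMem he.2] at this
    omega
  have h1 : joinBoundary s t X' w = joinBoundary s t Q w := by
    have := joinBoundary_apply_eq_zero hno
    rw [joinBoundary_sdiff hQX, Pi.add_apply] at this
    exact CharTwo.add_eq_zero.1 this
  have h2 : joinBoundary s t (X \ X') w ≠ 0 := fun h0 => by
    rw [joinBoundary_sdiff (Finset.filter_subset _ _), Pi.add_apply, h1, hw, hX] at h0
    simp only [Pi.add_apply, Pi.single_eq_same, Pi.single_eq_of_ne hwb] at h0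
    generalize (Pi.single a 1 : V → ZMod 2) w = z at h0
    revert z
    decide
  have h3 : ∃ e ∈ X \ X', e ∈ vertexStar s t w := by
    by_contra! h
    exact h2 (joinBoundary_apply_eq_zero h)
  obtain ⟨e, he, hew⟩ := h3
  simp only [hX', Finset.mem_sdiff, Finset.mem_filter, not_and, not_not] at he
  have heb := he.2 he.1
  have hebd : joinBoundary s t {e} = Pi.single w 1 + Pi.single b 1 := by
    rw [mem_vertexStar] at heb hew
    rw [joinBoundary_singleton]
    rcases heb.2 with h | h <;> rcases hew.2 with h' | h'
    · exact absurd (h'.symm.trans h) hwb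
    · rw [h, h', add_comm]
    · rw [h, h']
    · exact absurd (h'.symm.trans h) hwb
  have heQ : e ∉ Q := fun h => hQb e h heb
  refine ⟨e, he.1, heb, insert e Q,
    Finset.insert_subset he.1 (hQX.trans (Finset.filter_subset _ _)), ?_, fun f hf hfb => ?_⟩
  · rw [joinBoundary_insert heQ, hw, hebd]
    linear_combination add_self_eq_zero_of_zmod_two (Pi.single w 1)
  · rw [Finset.mem_insert] at hf
    exact hf.resolve_right fun h => hQb f h hfb

/-- In a multigraph with positive edge lengths, there is an odd vertex `b` such that joins using
several edges at `b` are not minimal. -/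
theorem exists_reducible_vertex [Fintype E] [Fintype V] {D : V → ZMod 2}
    (hpos : ∀ e, s e ≠ t e → 0 < c e) (hD : D ≠ 0)
    (hJ : ∃ J, joinBoundary s t J = D) :
    ∃ b, ∃ ε > 0, D b = 1 ∧ (vertexStar s t b).Nonempty ∧ (∀ e ∈ vertexStar s t b, ε ≤ c e) ∧
      ∀ J, joinBoundary s t J = D → 1 < (J.filter (· ∈ vertexStar s t b)).card →
        ∃ J', joinBoundary s t J' = D ∧
          ∑ e ∈ J', c e + ε * (J.filter (· ∈ vertexStar s t b)).card ≤ ∑ e ∈ J, c e := by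
  classical
  obtain ⟨J₀, hJ₀⟩ := hJ
  obtain ⟨J₁, hJ₁, hmin₁⟩ := Finset.exists_min_image
    (Finset.univ.filter (fun J => joinBoundary s t J = D)) (fun J => ∑ e ∈ J, c e)
    ⟨J₀, by simpa using hJ₀⟩
  simp only [Finset.mem_filter, Finset.mem_univ, true_and] at hJ₁ hmin₁
  obtain ⟨f₁, hf₁, hst₁⟩ : ∃ f ∈ J₁, s f ≠ t f := by
    by_contra! h
    refine hD ?_
    rw [← hJ₁, joinBoundary]
    exact Finset.sum_eq_zero fun e he => by rw [h e he, add_self_eq_zero_of_zmod_two]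
  obtain ⟨⟨a, b, K⟩, hK, hminK⟩ := Finset.exists_min_image
    (Finset.univ.filter (fun k : V × V × Finset E =>
      joinBoundary s t k.2.2 = D + Pi.single k.1 1 + Pi.single k.2.1 1))
    (fun k => ∑ e ∈ k.2.2, c e)
    ⟨(s f₁, t f₁, J₁.erase f₁), by
      simp only [Finset.mem_filter, Finset.mem_univ, true_and]
      rw [joinBoundary_erase hf₁, hJ₁, joinBoundary_singleton, add_assoc]⟩
  simp only [Finset.mem_filter, Finset.mem_univ, true_and, Prod.forall] at hK hminK
  have hKJ : ∑ e ∈ K, c e < ∑ e ∈ J₁, c e := by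
    have h1 := hminK (s f₁) (t f₁) (J₁.erase f₁) (by
      rw [joinBoundary_erase hf₁, hJ₁, joinBoundary_singleton, add_assoc])
    have h2 := Finset.add_sum_erase J₁ c hf₁
    have h3 := hpos f₁ hst₁
    linarith
  have hab : a ≠ b := fun h => by
    have := hmin₁ K (by
      rw [hK, h]
      linear_combination add_self_eq_zero_of_zmod_two (Pi.single b 1))
    linarith
  have hKb : ∀ e ∈ K, e ∉ vertexStar s t b := fun e he hb => by
    obtain ⟨b', hb'⟩ := exists_joinBoundary_singleton_of_mem_vertexStar hb
    have h1 := hminK a b' (K.erase e) (by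
      rw [joinBoundary_erase he, hK, hb']
      linear_combination add_self_eq_zero_of_zmod_two (Pi.single b 1))
    have h2 := Finset.add_sum_erase K c he
    have h3 := hpos e (mem_vertexStar.1 hb).1
    linarith
  have hDb : D b = 1 := by
    have := joinBoundary_apply_eq_zero hKb
    rw [hK] at this
    simp only [Pi.add_apply, Pi.single_eq_same, Pi.single_eq_of_ne hab.symm] at this
    generalize D b = d at this
    revert d
    decide
  have hne : (vertexStar s t b).Nonempty := by
    by_contra h
    have := joinBoundary_apply_eq_zero (s := s) (t := t) (J := J₁) (b := b)
      fun e _ he => h ⟨e, he⟩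
    rw [hJ₁, hDb] at this
    exact one_ne_zero this
  obtain ⟨f, hf, hminf⟩ := Finset.exists_min_image (vertexStar s t b) c hne
  have hfpos := hpos f (mem_vertexStar.1 hf).1
  have hE : (0 : ℝ) < Fintype.card E := by exact_mod_cast Fintype.card_pos_iff.2 ⟨f⟩
  have hE1 : (1 : ℝ) ≤ Fintype.card E := by exact_mod_cast Fintype.card_pos_iff.2 ⟨f⟩
  refine ⟨b, c f / Fintype.card E, div_pos hfpos hE, hDb, hne, fun e he =>
    (div_le_self hfpos.le hE1).trans (hminf e he), fun J hJ hcard => ?_⟩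
  have hX : joinBoundary s t (symmDiff J K) = Pi.single a 1 + Pi.single b 1 := by
    rw [joinBoundary_symmDiff, hJ, hK]
    linear_combination add_self_eq_zero_of_zmod_two D
  obtain ⟨e, heX, heb, P, hPX, hP, hPe⟩ := exists_mem_vertexStar_connecting hab hX
  obtain ⟨e₀, he₀, hne₀⟩ := Finset.exists_mem_ne hcard e
  rw [Finset.mem_filter] at he₀
  have he₀K : e₀ ∉ K := fun h => hKb e₀ h he₀.2
  set R := symmDiff J K \ P with hR
  have he₀R : e₀ ∈ R :=
    Finset.mem_sdiff.2 ⟨Finset.mem_symmDiff.2 (Or.inl ⟨he₀.1, he₀K⟩), fun h =>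
      hne₀ (hPe e₀ h he₀.2)⟩
  have hRb : joinBoundary s t R = 0 := by
    rw [hR, joinBoundary_sdiff hPX, hX, hP, add_self_eq_zero_of_zmod_two]
  have hsum := sum_symmDiff_add_sum_symmDiff c (Finset.sdiff_subset : R ⊆ symmDiff J K)
  have he₀KR : e₀ ∈ symmDiff K R := Finset.mem_symmDiff.2 (Or.inr ⟨he₀R, he₀K⟩)
  have h1 : ∑ e ∈ K, c e ≤ ∑ e ∈ (symmDiff K R).erase e₀, c e := by
    obtain ⟨b', hb'⟩ := exists_joinBoundary_singleton_of_mem_vertexStar he₀.2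
    refine hminK a b' _ ?_
    rw [joinBoundary_erase he₀KR, joinBoundary_symmDiff, hRb, hK, hb']
    linear_combination add_self_eq_zero_of_zmod_two (Pi.single b 1)
  have h2 := Finset.add_sum_erase (symmDiff K R) c he₀KR
  refine ⟨symmDiff J R, by rw [joinBoundary_symmDiff, hRb, hJ, add_zero], ?_⟩
  have h3 : c f / Fintype.card E * (J.filter (· ∈ vertexStar s t b)).card ≤ c f := by
    rw [div_mul_eq_mul_div, div_le_iff₀ hE]
    exact mul_le_mul_of_nonneg_left (by exact_mod_cast Finset.card_le_univ _) hfpos.le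
  have h4 := hminf e₀ he₀.2
  linarith

/-- The dominant of the `D`-join polytope is described by the cut inequalities. -/
theorem exists_join_sum_le [Fintype E] [Fintype V] (n : ℕ) : ∀ (s t : E → V) (c z : E → ℝ)
    (D : V → ZMod 2), (∀ e, 0 ≤ c e) → (∀ e, 0 ≤ z e) → (∃ J, joinBoundary s t J = D) →
    (∀ S : Finset V, ∑ x ∈ S, D x = 1 → 1 ≤ ∑ e with ¬(s e ∈ S ↔ t e ∈ S), z e) →
    (Finset.univ.filter (fun e => s e ≠ t e)).card < n →
    ∃ J, joinBoundary s t J = D ∧ ∑ e ∈ J, c e ≤ ∑ e, c e * z e := by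
  classical
  induction n with
  | zero => intro s t c z D _ _ _ _ h; exact absurd h (Nat.not_lt_zero _)
  | succ n ih =>
    intro s t c z D hc hz hJ hcut hn
    by_contra! hno
    obtain ⟨J₀, hJ₀⟩ := id hJ
    obtain ⟨J₁, hJ₁, hmin₁⟩ := Finset.exists_min_image
      (Finset.univ.filter (fun J => joinBoundary s t J = D)) (fun J => ∑ e ∈ J, c e)
      ⟨J₀, by simpa using hJ₀⟩
    simp only [Finset.mem_filter, Finset.mem_univ, true_and] at hJ₁ hmin₁
    set g := ∑ e ∈ J₁, c e - ∑ e, c e * z e with hg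
    have hgpos : 0 < g := sub_pos.2 (hno J₁ hJ₁)
    let C : Set (E → ℝ) := Set.Icc 0 c ∩
      ⋂ J : {J // joinBoundary s t J = D}, {d | g ≤ ∑ e ∈ J.1, d e - ∑ e, d e * z e}
    have hC : IsCompact C := by
      refine isCompact_Icc.inter_right (isClosed_iInter fun J => ?_)
      exact isClosed_le continuous_const (by fun_prop)
    have hCmem : ∀ d, d ∈ C ↔ (∀ e, 0 ≤ d e) ∧ (∀ e, d e ≤ c e) ∧
        ∀ J, joinBoundary s t J = D → g ≤ ∑ e ∈ J, d e - ∑ e, d e * z e := by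
      intro d
      simp only [C, Set.mem_inter_iff, Set.mem_Icc, Pi.le_def, Set.mem_iInter, Set.mem_ofPred_eq,
        Subtype.forall, Pi.zero_apply, and_assoc]
    have hcC : c ∈ C := (hCmem c).2 ⟨hc, fun _ => le_rfl, fun J hJ =>
      sub_le_sub_right (hmin₁ J hJ) _⟩
    obtain ⟨d, hdC, hmind⟩ := hC.exists_isMinOn ⟨c, hcC⟩
      (f := fun d => ∑ e, d e) (by fun_prop)
    obtain ⟨hd0, hdc, hdg⟩ := (hCmem d).1 hdC
    have hdz : 0 ≤ ∑ e, d e * z e := Finset.sum_nonneg fun e _ => mul_nonneg (hd0 e) (hz e)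
    by_cases hzero : ∃ e, s e ≠ t e ∧ d e = 0
    · obtain ⟨e₀, hst, hde⟩ := hzero
      let φ : V → V := fun x => if x = t e₀ then s e₀ else x
      have hbd : ∀ J, joinBoundary (φ ∘ s) (φ ∘ t) J =
          fun x => ∑ a with φ a = x, joinBoundary s t J a := fun J =>
        funext (joinBoundary_comp φ J)
      obtain ⟨J, hJb, hJd⟩ := ih (φ ∘ s) (φ ∘ t) d z (fun x => ∑ a with φ a = x, D a) hd0 hz
        ⟨J₀, by rw [hbd, hJ₀]⟩
        (fun S hS => by
          have := hcut (Finset.univ.filter (fun x => φ x ∈ S)) (by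
            rw [← hS, ← Finset.sum_fiberwise_of_maps_to (t := S) (g := φ) (fun x hx => by
              simpa using hx)]
            refine Finset.sum_congr rfl fun x hx => Finset.sum_congr ?_ fun _ _ => rfl
            ext a
            simp only [Finset.mem_filter, Finset.mem_univ, true_and, and_iff_right_iff_imp]
            rintro rfl
            exact hx)
          simpa using this)
        (lt_of_lt_of_le (Finset.card_lt_card ⟨fun e he => by
            simp only [Finset.mem_filter, Finset.mem_univ, true_and, Function.comp_apply] at he ⊢
            exact fun h => he (by rw [h]), fun h => by
            have := h (show e₀ ∈ Finset.univ.filter (fun e => s e ≠ t e) by simpa using hst)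
            simp [φ] at this⟩) (Nat.lt_succ_iff.1 hn))
      have hfib : ∀ x, ∑ a with φ a = x, joinBoundary s t J a = ∑ a with φ a = x, D a :=
        fun x => by rw [← joinBoundary_comp φ J x, hJb]
      have hout : ∀ x, x ≠ s e₀ → x ≠ t e₀ → joinBoundary s t J x = D x := fun x h1 h2 => by
        have : Finset.univ.filter (fun a => φ a = x) = {x} := by
          ext a
          simp only [φ, Finset.mem_filter, Finset.mem_univ, true_and, Finset.mem_singleton]
          split_ifs with h
          · exact ⟨fun h' => absurd h'.symm h1, fun h' => absurd (h'.symm.trans h) h2⟩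
          · rfl
        simpa [this] using hfib x
      have hin : joinBoundary s t J (s e₀) + joinBoundary s t J (t e₀) = D (s e₀) + D (t e₀) := by
        have : Finset.univ.filter (fun a => φ a = s e₀) = {s e₀, t e₀} := by
          ext a
          simp only [φ, Finset.mem_filter, Finset.mem_univ, true_and, Finset.mem_singleton,
            Finset.mem_insert]
          split_ifs with h <;> simp [h]
        simpa [this, Finset.sum_pair hst] using hfib (s e₀)
      by_cases hs : joinBoundary s t J (s e₀) = D (s e₀)
      · have : joinBoundary s t J = D := by
          funext x
          by_cases h1 : x = s e₀
          · rw [h1, hs]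
          · by_cases h2 : x = t e₀
            · rw [hs] at hin
              rw [h2, add_left_cancel hin]
            · exact hout x h1 h2
        linarith [hdg J this]
      · have key : ∀ p q p' q' : ZMod 2, p ≠ p' → p + q = p' + q' → p + 1 = p' ∧ q + 1 = q' := by
          decide
        obtain ⟨k1, k2⟩ := key _ _ _ _ hs hin
        have : joinBoundary s t (symmDiff J {e₀}) = D := by
          rw [joinBoundary_symmDiff, joinBoundary_singleton]
          funext x
          simp only [Pi.add_apply]
          by_cases h1 : x = s e₀
          · rw [h1, Pi.single_eq_same, Pi.single_eq_of_ne hst, add_zero, k1]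
          · by_cases h2 : x = t e₀
            · rw [h2, Pi.single_eq_same, Pi.single_eq_of_ne (Ne.symm hst), zero_add, k2]
            · rw [Pi.single_eq_of_ne h1, Pi.single_eq_of_ne h2, hout x h1 h2]
              simp
        have h1 := hdg _ this
        have h2 : ∑ e ∈ symmDiff J {e₀}, d e ≤ ∑ e ∈ J, d e := by
          have h3 : ∑ e ∈ symmDiff J {e₀}, d e ≤ ∑ e ∈ insert e₀ J, d e :=
            Finset.sum_le_sum_of_subset_of_nonneg (fun e he => by
              simp only [Finset.mem_symmDiff, Finset.mem_singleton, Finset.mem_insert] at he ⊢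
              tauto) fun e _ _ => hd0 e
          rwa [Finset.sum_insert_of_eq_zero_if_notMem fun _ => hde] at h3
        linarith
    · push Not at hzero
      have hpos : ∀ e, s e ≠ t e → 0 < d e := fun e he =>
        lt_of_le_of_ne (hd0 e) (Ne.symm (hzero e he))
      by_cases hD : D = 0
      · have := hdg ∅ (by simp [joinBoundary, hD])
        rw [Finset.sum_empty] at this
        linarith
      · obtain ⟨b, ε, hε, hDb, hne, hεd, hred⟩ := exists_reducible_vertex hpos hD hJ
        set B := vertexStar s t b with hB
        have hBcut : B = Finset.univ.filter
            (fun e => ¬(s e ∈ ({b} : Finset V) ↔ t e ∈ ({b} : Finset V))) := by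
          ext e
          simp only [hB, mem_vertexStar, Finset.mem_filter, Finset.mem_univ, true_and,
            Finset.mem_singleton]
          by_cases h1 : s e = b <;> by_cases h2 : t e = b <;> simp [h1, h2]
          exact fun h => h2 h.symm
        have hzB : 1 ≤ ∑ e ∈ B, z e := hBcut ▸ hcut {b} (by simpa using hDb)
        let d' : E → ℝ := fun e => d e - if e ∈ B then ε else 0
        have hsumJ : ∀ J : Finset E, ∑ e ∈ J, d' e =
            ∑ e ∈ J, d e - ε * (J.filter (· ∈ B)).card := fun J => by
          simp only [d', Finset.sum_sub_distrib, ← Finset.sum_filter, Finset.sum_const,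
            nsmul_eq_mul]
          ring
        have hsumz : ∑ e, d' e * z e = ∑ e, d e * z e - ε * ∑ e ∈ B, z e := by
          simp only [d', sub_mul, Finset.sum_sub_distrib, ite_mul, zero_mul]
          rw [← Finset.sum_filter, Finset.filter_mem_eq_inter, Finset.univ_inter, Finset.mul_sum]
        have hd'C : d' ∈ C := by
          refine (hCmem d').2 ⟨fun e => ?_, fun e => ?_, fun J hJ => ?_⟩
          · simp only [d']
            split_ifs with h
            · linarith [hεd e h]
            · linarith [hd0 e]
          · simp only [d']
            split_ifs with h
            · linarith [hdc e]
            · linarith [hdc e]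
          · rw [hsumJ, hsumz]
            have hεz := mul_le_mul_of_nonneg_left hzB hε.le
            by_cases hk : 1 < (J.filter (· ∈ B)).card
            · obtain ⟨J', hJ', hle⟩ := hred J hJ hk
              linarith [hdg J' hJ']
            · have hk' : ((J.filter (· ∈ B)).card : ℝ) ≤ 1 := by exact_mod_cast not_lt.1 hk
              have := mul_le_mul_of_nonneg_left hk' hε.le
              linarith [hdg J hJ]
        have h1 := hmind hd'C
        simp only [Set.mem_ofPred_eq, hsumJ Finset.univ] at h1
        have h2 : 0 < (Finset.univ.filter (· ∈ B)).card := by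
          rw [Finset.filter_mem_eq_inter, Finset.univ_inter]
          exact Finset.card_pos.2 hne
        have h3 : (0 : ℝ) < (Finset.univ.filter (· ∈ B)).card := by exact_mod_cast h2
        have := mul_pos hε h3
        linarith

end

section
variable {V : Type*} {C : V → V → ℝ}

/-- The length of the path visiting the vertices of a list in order. -/
def pathCost (C : V → V → ℝ) : List V → ℝ
  | [] => 0
  | [_] => 0
  | a :: b :: l => C a b + pathCost C (b :: l)

theorem pathCost_append_cons (l₁ : List V) (a : V) (l₂ : List V) :
    pathCost C (l₁ ++ a :: l₂) = pathCost C (l₁ ++ [a]) + pathCost C (a :: l₂) := by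
  induction l₁ with
  | nil => simp [pathCost]
  | cons b l ih =>
    cases l with
    | nil => simp [pathCost]
    | cons d l => simp only [List.cons_append, pathCost] at ih ⊢; rw [ih]; ring

theorem pathCost_nonneg (h0 : ∀ a b, 0 ≤ C a b) (l : List V) : 0 ≤ pathCost C l := by
  induction l with
  | nil => exact le_rfl
  | cons a l ih =>
    cases l with
    | nil => exact le_rfl
    | cons b l => exact add_nonneg (h0 a b) ih

theorem pathCost_cons_le_of_sublist (h0 : ∀ a b, 0 ≤ C a b)
    (htri : ∀ a b d, C a d ≤ C a b + C b d) {l₁ l₂ : List V} (h : l₁.Sublist l₂) :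
    ∀ a, pathCost C (a :: l₁) ≤ pathCost C (a :: l₂) := by
  induction h with
  | slnil => exact fun a => le_rfl
  | @cons l₁ l₂ b _ ih =>
    intro a
    have h1 : pathCost C (a :: l₁) ≤ C a b + pathCost C (b :: l₁) := by
      cases l₁ with
      | nil => simpa [pathCost] using h0 a b
      | cons d l => simp only [pathCost]; linarith [htri a b d]
    exact h1.trans (add_le_add le_rfl (ih b))
  | @cons_cons l₁ l₂ b _ ih => exact fun a => add_le_add le_rfl (ih b)

theorem sum_zip_eq_pathCost [DecidableEq V] {c : Finset V → ℝ}
    (hC : ∀ a b, a ≠ b → C a b = c {a, b}) (b : V) (l : List V) :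
    ∀ a, (a :: l).Nodup → b ∉ l → (l = [] → a ≠ b) →
      (((a :: l).zip (l ++ [b])).map (fun p => c {p.1, p.2})).sum =
        pathCost C (a :: (l ++ [b])) := by
  induction l with
  | nil => intro a _ _ h; simp [pathCost, hC a b (h rfl)]
  | cons d l ih =>
    intro a hnd hb _
    rw [List.nodup_cons, List.mem_cons, not_or] at hnd
    rw [List.mem_cons, not_or] at hb
    have := ih d hnd.2 hb.2 fun _ => Ne.symm hb.1
    simp only [List.cons_append, List.zip_cons_cons, List.map_cons, List.sum_cons, pathCost] at this ⊢
    rw [this, hC a d hnd.1.1]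

/-- Shortcutting a closed walk from `r` to a tour. -/
theorem exists_tour_of_pathCost [DecidableEq V] {c : Finset V → ℝ}
    (hC : ∀ a b, a ≠ b → C a b = c {a, b}) (h0 : ∀ a b, 0 ≤ C a b)
    (htri : ∀ a b d, C a d ≤ C a b + C b d) (r : V) (l : List V) :
    ∃ t : List V, t.Nodup ∧ t.head? = some r ∧ (r :: (l ++ [r])).toFinset ⊆ t.toFinset ∧
      tourCost c t ≤ pathCost C (r :: (l ++ [r])) := by
  set l' := (l.filter (· ≠ r)).dedup with hl'
  have hr : r ∉ l' := by simp [hl']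
  have hnd : (r :: l').Nodup := List.nodup_cons.2 ⟨hr, List.nodup_dedup _⟩
  refine ⟨r :: l', hnd, rfl, fun a ha => ?_, ?_⟩
  · simp only [hl', List.toFinset_cons, List.toFinset_append, Finset.mem_insert,
      Finset.mem_union, List.mem_toFinset, List.mem_dedup, List.mem_filter, List.toFinset_nil,
      Finset.notMem_empty, or_false, decide_eq_true_eq] at ha ⊢
    tauto
  · unfold tourCost
    split_ifs with h
    · exact pathCost_nonneg h0 _
    · have hne : l' ≠ [] := fun h' => h (by simp [h'])
      have hrot : (r :: l').rotate 1 = l' ++ [r] := by simp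
      rw [hrot, sum_zip_eq_pathCost hC r l' r hnd hr fun h' => absurd h' hne]
      exact pathCost_cons_le_of_sublist h0 htri
        (((List.dedup_sublist _).trans List.filter_sublist).append_right [r]) r

end

section
variable {E V : Type*} [DecidableEq V] {s t : E → V} {ℓ : E → ℝ} {C : V → V → ℝ}

/-- The walk from `a` to `b` through `l` uses every edge of `Q` at most once. -/
structure IsTrail (s t : E → V) (ℓ : E → ℝ) (C : V → V → ℝ) (Q : Finset E) (a b : V)
    (l : List V) : Prop where
  boundary : joinBoundary s t Q = Pi.single a 1 + Pi.single b 1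
  cost : pathCost C (a :: (l ++ [b])) ≤ ∑ e ∈ Q, ℓ e
  mem : ∀ e ∈ Q, s e ∈ a :: (l ++ [b]) ∧ t e ∈ a :: (l ++ [b])

theorem isTrail_empty (hdiag : ∀ a, C a a = 0) (a : V) : IsTrail s t ℓ C ∅ a a [] where
  boundary := by rw [add_self_eq_zero_of_zmod_two]; rfl
  cost := by simp [pathCost, hdiag]
  mem e he := by simp at he

variable [DecidableEq E]

theorem IsTrail.insert {Q : Finset E} {a b d : V} {l : List V} {e : E}
    (h : IsTrail s t ℓ C Q a b l) (he : e ∉ Q) (hC : C b d ≤ ℓ e)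
    (hbd : s e = b ∧ t e = d ∨ s e = d ∧ t e = b) :
    IsTrail s t ℓ C (insert e Q) a d (l ++ [b]) where
  boundary := by
    have : joinBoundary s t {e} = Pi.single b 1 + Pi.single d 1 := by
      rw [joinBoundary_singleton]
      rcases hbd with ⟨rfl, rfl⟩ | ⟨rfl, rfl⟩
      · rfl
      · rw [add_comm]
    rw [joinBoundary_insert he, h.boundary, this]
    linear_combination add_self_eq_zero_of_zmod_two (Pi.single b 1)
  cost := by
    have := pathCost_append_cons (C := C) (a :: l) b [d]
    simp only [List.cons_append, List.append_assoc, List.nil_append, pathCost] at this ⊢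
    rw [this, Finset.sum_insert he]
    have := h.cost
    linarith
  mem f hf := by
    rcases Finset.mem_insert.1 hf with rfl | hf
    · rcases hbd with ⟨rfl, rfl⟩ | ⟨rfl, rfl⟩ <;> simp
    · have := h.mem f hf
      simp only [List.mem_cons, List.mem_append, List.not_mem_nil, or_false] at this ⊢
      tauto

theorem IsTrail.splice {Q Q' : Finset E} {a w : V} {l l' : List V}
    (h : IsTrail s t ℓ C Q a a l) (h' : IsTrail s t ℓ C Q' w w l') (hQ : Disjoint Q Q')
    (hw : w ∈ a :: (l ++ [a])) : ∃ m, IsTrail s t ℓ C (Q ∪ Q') a a m := by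
  have hb : joinBoundary s t (Q ∪ Q') = Pi.single a 1 + Pi.single a 1 := by
    have : joinBoundary s t (Q ∪ Q') = joinBoundary s t Q + joinBoundary s t Q' :=
      Finset.sum_union hQ
    rw [this, h.boundary, h'.boundary]
    simp only [add_self_eq_zero_of_zmod_two, add_zero]
  have hcl := h.cost
  have hcl' := h'.cost
  have hsum := Finset.sum_union (f := ℓ) hQ
  by_cases hwa : w = a
  · subst hwa
    refine ⟨l ++ w :: l', hb, ?_, fun e he => ?_⟩
    · have := pathCost_append_cons (C := C) (w :: l) w (l' ++ [w])
      simp only [List.cons_append, List.append_assoc] at this ⊢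
      linarith
    · rcases Finset.mem_union.1 he with he | he
      · have := h.mem e he
        simp only [List.mem_cons, List.mem_append, List.not_mem_nil, or_false] at this ⊢
        tauto
      · have := h'.mem e he
        simp only [List.mem_cons, List.mem_append, List.not_mem_nil, or_false] at this ⊢
        tauto
  · have hwl : w ∈ l := by
      simp only [List.mem_cons, List.mem_append, List.not_mem_nil, or_false] at hw
      tauto
    obtain ⟨l₁, l₂, rfl⟩ := List.append_of_mem hwl
    refine ⟨l₁ ++ w :: (l' ++ w :: l₂), hb, ?_, fun e he => ?_⟩
    · have e1 := pathCost_append_cons (C := C) (a :: l₁) w (l' ++ w :: (l₂ ++ [a]))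
      have e2 := pathCost_append_cons (C := C) (w :: l') w (l₂ ++ [a])
      have e3 := pathCost_append_cons (C := C) (a :: l₁) w (l₂ ++ [a])
      simp only [List.cons_append, List.append_assoc] at e1 e2 e3 hcl ⊢
      linarith
    · rcases Finset.mem_union.1 he with he | he
      · have := h.mem e he
        simp only [List.mem_cons, List.mem_append, List.not_mem_nil, or_false] at this ⊢
        tauto
      · have := h'.mem e he
        simp only [List.mem_cons, List.mem_append, List.not_mem_nil, or_false] at this ⊢
        tauto

theorem exists_closed_trail [Fintype E] {G : Finset E} (hG : joinBoundary s t G = 0)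
    (hs : ∀ a b, C a b = C b a) (hdiag : ∀ a, C a a = 0) (hℓ : ∀ e, C (s e) (t e) ≤ ℓ e)
    {w : V} {e₀ : E} (he₀ : e₀ ∈ G) (hw : e₀ ∈ vertexStar s t w) :
    ∃ Q ⊆ G, Q.Nonempty ∧ ∃ l, IsTrail s t ℓ C Q w w l := by
  classical
  obtain ⟨Q, hQ, hmax⟩ := Finset.exists_max_image
    (G.powerset.filter (fun Q => ∃ b l, IsTrail s t ℓ C Q w b l)) Finset.card
    ⟨∅, by simpa using ⟨w, [], isTrail_empty hdiag w⟩⟩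
  simp only [Finset.mem_filter, Finset.mem_powerset] at hQ hmax
  obtain ⟨hQG, b, l, hl⟩ := hQ
  have hno : ∀ e ∈ G \ Q, e ∉ vertexStar s t b := fun e he heb => by
    rw [Finset.mem_sdiff] at he
    have hext : ∃ d, IsTrail s t ℓ C (insert e Q) w d (l ++ [b]) := by
      rcases (mem_vertexStar.1 heb).2 with h | h
      · exact ⟨t e, hl.insert he.2 (h ▸ hℓ e) (Or.inl ⟨h, rfl⟩)⟩
      · exact ⟨s e, hl.insert he.2 (h ▸ hs _ _ ▸ hℓ e) (Or.inr ⟨rfl, h⟩)⟩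
    obtain ⟨d, hd⟩ := hext
    have := hmax (insert e Q) ⟨Finset.insert_subset he.1 hQG, d, _, hd⟩
    rw [Finset.card_insert_of_notMem he.2] at this
    omega
  have hb := joinBoundary_apply_eq_zero hno
  rw [joinBoundary_sdiff hQG, hG, zero_add, hl.boundary] at hb
  have hwb : w = b := by
    by_contra h
    simp [Pi.single_eq_of_ne (Ne.symm h)] at hb
  subst hwb
  refine ⟨Q, hQG, ?_, l, hl⟩
  by_contra hne
  rw [Finset.not_nonempty_iff_eq_empty] at hne
  exact hno e₀ (by simp [hne, he₀]) hw

/-- A connected even multigraph has a closed walk through all of its required vertices. -/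
theorem exists_closed_walk [Fintype E] [Fintype V] {F : Finset E} {W : Finset V} {r : V}
    (hF : joinBoundary s t F = 0)
    (hs : ∀ a b, C a b = C b a) (hdiag : ∀ a, C a a = 0) (h0 : ∀ a b, 0 ≤ C a b)
    (hℓ : ∀ e, C (s e) (t e) ≤ ℓ e)
    (hconn : ∀ S : Finset V, r ∉ S → (S ∩ W).Nonempty → ∃ e ∈ F, ¬(s e ∈ S ↔ t e ∈ S)) :
    ∃ l : List V, W ⊆ (r :: (l ++ [r])).toFinset ∧
      pathCost C (r :: (l ++ [r])) ≤ ∑ e ∈ F, ℓ e := by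
  classical
  obtain ⟨Q, hQ, hmax⟩ := Finset.exists_max_image
    (F.powerset.filter (fun Q => ∃ l, IsTrail s t ℓ C Q r r l)) Finset.card
    ⟨∅, by simpa using ⟨[], isTrail_empty hdiag r⟩⟩
  simp only [Finset.mem_filter, Finset.mem_powerset] at hQ hmax
  obtain ⟨hQF, l, hl⟩ := hQ
  refine ⟨l, ?_, hl.cost.trans (Finset.sum_le_sum_of_subset_of_nonneg hQF fun e _ _ =>
    (h0 _ _).trans (hℓ e))⟩
  by_contra hsub
  obtain ⟨a, haW, ha⟩ := Finset.not_subset.1 hsub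
  obtain ⟨e, heF, he⟩ := hconn (r :: (l ++ [r])).toFinsetᶜ (by simp)
    ⟨a, Finset.mem_inter.2 ⟨Finset.mem_compl.2 ha, haW⟩⟩
  simp only [Finset.mem_compl, List.mem_toFinset] at he
  have heQ : e ∉ Q := fun h => by
    have := hl.mem e h
    tauto
  have hst : s e ≠ t e := fun h => he (by rw [h])
  obtain ⟨w, hw, hew⟩ : ∃ w ∈ r :: (l ++ [r]), e ∈ vertexStar s t w := by
    by_cases h : s e ∈ r :: (l ++ [r])
    · exact ⟨_, h, mem_vertexStar.2 ⟨hst, Or.inl rfl⟩⟩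
    · exact ⟨t e, by tauto, mem_vertexStar.2 ⟨hst, Or.inr rfl⟩⟩
  have hG : joinBoundary s t (F \ Q) = 0 := by
    rw [joinBoundary_sdiff hQF, hF, hl.boundary, add_self_eq_zero_of_zmod_two, add_zero]
  obtain ⟨Q', hQ', hne, l', hl'⟩ := exists_closed_trail hG hs hdiag hℓ
    (Finset.mem_sdiff.2 ⟨heF, heQ⟩) hew
  have hdis : Disjoint Q Q' := Finset.disjoint_of_subset_right hQ' Finset.disjoint_sdiff
  obtain ⟨m, hm⟩ := hl.splice hl' hdis hw
  have := hmax (Q ∪ Q') ⟨Finset.union_subset hQF (hQ'.trans Finset.sdiff_subset), m, hm⟩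
  rw [Finset.card_union_of_disjoint hdis] at this
  have := hne.card_pos
  omega

end

/-- Random thresholds: some threshold does at least as well as the average over `(0, 1]`. -/
theorem exists_threshold_sum_le {ι : Type*} (s : Finset ι) (a g : ι → ℝ)
    (hg : ∀ i ∈ s, 0 ≤ g i ∧ g i ≤ 1) :
    ∃ θ : ℝ, 0 < θ ∧ θ ≤ 1 ∧
      ∑ i ∈ s, (if θ ≤ g i then a i else 0) ≤ ∑ i ∈ s, a i * g i := by
  have hI : ∀ i, (fun θ : ℝ => if θ ≤ g i then a i else 0) = (Set.Iic (g i)).indicator fun _ => a i :=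
    fun i => by
      funext θ
      simp [Set.indicator_apply]
  have hint : ∀ i ∈ s, MeasureTheory.IntegrableOn (fun θ : ℝ => if θ ≤ g i then a i else 0)
      (Set.Ioc 0 1) MeasureTheory.volume := fun i _ => by
    rw [hI i]
    exact MeasureTheory.IntegrableOn.indicator (by simp) measurableSet_Iic
  obtain ⟨θ, hθ, h⟩ := MeasureTheory.exists_le_setAverage (μ := MeasureTheory.volume)
    (s := Set.Ioc (0 : ℝ) 1) (f := fun θ => ∑ i ∈ s, (if θ ≤ g i then a i else 0))
    (by simp) (by simp) (MeasureTheory.integrable_finsetSum s hint)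
  refine ⟨θ, hθ.1, hθ.2, h.trans (le_of_eq ?_)⟩
  rw [MeasureTheory.setAverage_eq, MeasureTheory.integral_finsetSum s hint]
  simp only [MeasureTheory.measureReal_def, Real.volume_Ioc, sub_zero, ENNReal.ofReal_one,
    ENNReal.toReal_one, inv_one, one_smul]
  refine Finset.sum_congr rfl fun i hi => ?_
  rw [hI i, MeasureTheory.setIntegral_indicator measurableSet_Iic, MeasureTheory.setIntegral_const,
    Set.Ioc_inter_Iic, min_eq_right (hg i hi).2, MeasureTheory.measureReal_def, Real.volume_Ioc,
    sub_zero, ENNReal.toReal_ofReal (hg i hi).1, smul_eq_mul, mul_comm]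

section
variable {V : Type*} [DecidableEq V]

theorem sum_ite_graph (U : Finset (V × V)) (A : Finset V) (p : V → V) (f : V × V → ℝ) :
    ∑ e ∈ U, (if e.1 ∈ A ∧ e.2 = p e.1 then f e else 0) =
      ∑ u ∈ A with (u, p u) ∈ U, f (u, p u) := by
  rw [← Finset.sum_filter]
  symm
  refine Finset.sum_bij (fun u _ => (u, p u)) ?_ ?_ ?_ fun _ _ => rfl
  · intro u hu
    rw [Finset.mem_filter] at hu
    simp [hu.1, hu.2]
  · exact fun a _ b _ h => (Prod.ext_iff.1 h).1
  · rintro ⟨a, b⟩ h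
    simp only [Finset.mem_filter] at h
    exact ⟨a, by simp [h.2.1, ← h.2.2, h.1], by simp [h.2.2]⟩

variable [Fintype V]

theorem sum_cutEdges (f : Finset V → ℝ) (S : Finset V) :
    ∑ e ∈ cutEdges V S, f e = ∑ a ∈ S, ∑ b ∈ Sᶜ, f {a, b} := by
  rw [← Finset.sum_product']
  symm
  refine Finset.sum_bij (fun k _ => {k.1, k.2}) ?_ ?_ ?_ fun _ _ => rfl
  · rintro ⟨a, b⟩ h
    rw [Finset.mem_product, Finset.mem_compl] at h
    change a ∈ S ∧ b ∉ S at h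
    have hab : a ≠ b := fun e => h.2 (e ▸ h.1)
    have : ({a, b} : Finset V) ∩ S = {a} := by
      rw [Finset.insert_inter_of_mem h.1, Finset.singleton_inter_of_notMem h.2]
      rfl
    simp [cutEdges, completeEdges, Finset.mem_powersetCard, Finset.card_pair hab, this]
  · rintro ⟨a, b⟩ h ⟨a', b'⟩ h' he
    rw [Finset.mem_product, Finset.mem_compl] at h h'
    simp only at h h' he
    have h1 : a ∈ ({a', b'} : Finset V) := he ▸ by simp
    have h2 : b ∈ ({a', b'} : Finset V) := he ▸ by simp
    simp only [Finset.mem_insert, Finset.mem_singleton] at h1 h2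
    rcases h1 with rfl | rfl
    · rcases h2 with rfl | rfl
      · exact absurd h.1 h.2
      · rfl
    · exact absurd h.1 h'.2
  · intro e he
    simp only [cutEdges, completeEdges, Finset.mem_filter, Finset.mem_powersetCard,
      Finset.subset_univ, true_and] at he
    obtain ⟨a, ha⟩ := Finset.card_eq_one.1 he.2
    have hae : a ∈ e ∩ S := by simp [ha]
    rw [Finset.mem_inter] at hae
    obtain ⟨b, hb⟩ := Finset.card_eq_one.1 (by
      rw [Finset.card_erase_of_mem hae.1, he.1] : (e.erase a).card = 1)
    have hbe : b ∈ e.erase a := by simp [hb]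
    rw [Finset.mem_erase] at hbe
    have hbS : b ∉ S := fun h => hbe.1 (by
      have : b ∈ e ∩ S := Finset.mem_inter.2 ⟨hbe.2, h⟩
      simpa [ha] using this)
    refine ⟨(a, b), by simp [hae.2, hbS], ?_⟩
    simp only
    rw [← hb, Finset.insert_erase hae.1]

theorem two_mul_sum_completeEdges (f : Finset V → ℝ) :
    2 * ∑ e ∈ completeEdges V, f e = ∑ a, ∑ b, if a = b then 0 else f {a, b} := by
  have h1 : ∀ a : V, (∑ b, if a = b then 0 else f {a, b}) = ∑ e ∈ cutEdges V {a}, f e := by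
    intro a
    rw [sum_cutEdges, Finset.sum_singleton, ← Finset.sum_compl_add_sum {a}, Finset.sum_singleton,
      if_pos rfl, add_zero]
    refine Finset.sum_congr rfl fun b hb => if_neg fun h => ?_
    simp [h] at hb
  simp only [h1, cutEdges, Finset.sum_filter]
  rw [Finset.sum_comm, Finset.mul_sum]
  refine Finset.sum_congr rfl fun e he => ?_
  rw [completeEdges, Finset.mem_powersetCard] at he
  rw [← Finset.sum_filter, Finset.sum_const, nsmul_eq_mul]
  have : Finset.univ.filter (fun a => (e ∩ {a}).card = 1) = e := by
    ext a
    by_cases h : a ∈ e <;> simp [h]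
  rw [this, he.2]
  norm_num

theorem sum_crossing_eq {X : V → V → ℝ} (hX : ∀ a b, X a b = X b a) (S : Finset V) :
    ∑ e : V × V with ¬(e.1 ∈ S ↔ e.2 ∈ S), X e.1 e.2 = 2 * ∑ a ∈ S, ∑ b ∈ Sᶜ, X a b := by
  have : Finset.univ.filter (fun e : V × V => ¬(e.1 ∈ S ↔ e.2 ∈ S)) = S ×ˢ Sᶜ ∪ Sᶜ ×ˢ S := by
    ext e
    simp only [Finset.mem_filter, Finset.mem_univ, true_and, Finset.mem_union, Finset.mem_product,
      Finset.mem_compl]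
    tauto
  rw [this, Finset.sum_union, Finset.sum_product, Finset.sum_product_right, two_mul]
  · simp only [hX]
  · rw [Finset.disjoint_left]
    intro e
    simp only [Finset.mem_product, Finset.mem_compl]
    tauto

end

/-- The probability that a vertex of (subtree) value `t` survives pruning. -/
noncomputable def survival (β κ t : ℝ) : ℝ := (1 - β * κ) / (1 - β * min t κ)

section
variable {β κ : ℝ}

theorem one_sub_mul_min_pos (hβ : 0 ≤ β) (h : β * κ < 1) (t : ℝ) : 0 < 1 - β * min t κ := by
  have := mul_le_mul_of_nonneg_left (min_le_right t κ) hβ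
  linarith

theorem survival_nonneg (hβ : 0 ≤ β) (h : β * κ < 1) (t : ℝ) : 0 ≤ survival β κ t :=
  div_nonneg (by linarith) (one_sub_mul_min_pos hβ h t).le

theorem survival_le_one (hβ : 0 ≤ β) (h : β * κ < 1) (t : ℝ) : survival β κ t ≤ 1 := by
  rw [survival, div_le_one (one_sub_mul_min_pos hβ h t)]
  have := mul_le_mul_of_nonneg_left (min_le_right t κ) hβ
  linarith

theorem survival_of_le (h : β * κ < 1) {t : ℝ} (ht : κ ≤ t) : survival β κ t = 1 := by
  rw [survival, min_eq_right ht, div_self (by linarith)]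

theorem survival_mono (hβ : 0 ≤ β) (h : β * κ < 1) {t u : ℝ} (htu : t ≤ u) :
    survival β κ t ≤ survival β κ u := by
  refine div_le_div_of_nonneg_left (by linarith) (one_sub_mul_min_pos hβ h u) ?_
  have := mul_le_mul_of_nonneg_left (min_le_min_right κ htu) hβ
  linarith

theorem survival_mul_le (hβ : 0 ≤ β) (h : β * κ < 1) (t : ℝ) :
    (2 - 2 * β * t) * survival β κ t ≤ 2 - 2 * β * κ := by
  rcases le_total t κ with ht | ht
  · have h1 := one_sub_mul_min_pos hβ h t
    rw [survival, min_eq_left ht] at *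
    rw [← mul_div_assoc, div_le_iff₀ h1]
    linarith
  · rw [survival_of_le h ht]
    have := mul_le_mul_of_nonneg_left ht hβ
    linarith

theorem one_sub_survival_mul_le (hβ : 0 ≤ β) (h : β * κ < 1) (hκ1 : κ ≤ 1) {t α : ℝ}
    (ht0 : 0 ≤ t) (ht1 : t ≤ 1) (hα1 : 1 ≤ α) (hα : 1 ≤ α * (1 - β * κ)) :
    1 - survival β κ t * t ≤ α * (1 - t) := by
  rcases le_total t κ with ht | ht
  · have h1 := one_sub_mul_min_pos hβ h t
    rw [survival, min_eq_left ht] at *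
    have h2 : 1 - (1 - β * κ) / (1 - β * t) * t = ((1 - t) - β * t * (1 - κ)) / (1 - β * t) := by
      field_simp
      ring
    rw [h2, div_le_iff₀ h1]
    have h3 : 0 ≤ β * t * (1 - κ) := mul_nonneg (mul_nonneg hβ ht0) (by linarith)
    have h4 : 1 ≤ α * (1 - β * t) := by
      have := mul_le_mul_of_nonneg_left ht hβ
      nlinarith
    nlinarith [mul_le_mul_of_nonneg_right h4 (sub_nonneg.2 ht1)]
  · rw [survival_of_le h ht]
    nlinarith [mul_le_mul_of_nonneg_right hα1 (sub_nonneg.2 ht1)]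

end

section
variable {V : Type*} [Fintype V] [DecidableEq V] {r : V} {C X : V → V → ℝ} {y π : V → ℝ}

/-- The core of a tree obtained by pruning at threshold `θ` extends to a closed walk whose expected
cost is controlled by the fractional solution. -/
theorem exists_closed_walk_of_core {W K : Finset V} {p : V → V} {η : V → ℝ} {β δ : ℝ}
    (hC0 : ∀ a b, 0 ≤ C a b) (hCs : ∀ a b, C a b = C b a) (hCd : ∀ a, C a a = 0)
    (hX0 : ∀ a b, 0 ≤ X a b) (hXs : ∀ a b, X a b = X b a)
    (hcut : ∀ S : Finset V, r ∉ S → ∀ v ∈ S, 2 * y v ≤ ∑ a ∈ S, ∑ b ∈ Sᶜ, X a b)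
    (hβ0 : 0 ≤ β) (hβ : β * (3 - δ) = 1) (hβ2 : 2 * β ≤ 1)
    (hT : IsRootedTree r W p) (hη : IsSubtreeMax r W p y η) (hK : IsRootedTree r K p)
    (hKW : K ⊆ W) (hKη : ∀ a ∈ W, ∀ b ∈ K, η a = η b → a ∈ K)
    (hδ : ∀ v ∈ W, δ ≤ y v) (hy : ∀ v ∈ W, y v ≤ 1) :
    ∃ l : List V, K ⊆ (r :: (l ++ [r])).toFinset ∧ pathCost C (r :: (l ++ [r])) ≤
      β * ((∑ a, ∑ b, C a b * X a b) / 2) +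
        ∑ u ∈ K.erase r, C u (p u) * (2 - 2 * β * η u) := by
  classical
  have hη1 : ∀ u ∈ W, η u ≤ 1 := fun u hu => by
    obtain ⟨w, hw, h⟩ := hη.exists_eq u hu
    exact h ▸ hy w hw
  set T : Finset (V × V) := (K.erase r).image (fun u => (u, p u)) with hTdef
  have hinj : Function.Injective (fun u : V => (u, p u)) := fun a b h => (Prod.ext_iff.1 h).1
  set D := joinBoundary Prod.fst Prod.snd T with hD
  let z : V × V → ℝ := fun e => β * (X e.1 e.2 / 2) +
    if e.1 ∈ K.erase r ∧ e.2 = p e.1 then 1 - 2 * β * η e.1 else 0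
  have hz : ∀ e, 0 ≤ z e := fun e => by
    refine add_nonneg (mul_nonneg hβ0 (by linarith [hX0 e.1 e.2])) ?_
    split_ifs with h
    · have := mul_le_mul_of_nonneg_left (hη1 e.1 (hKW (Finset.mem_of_mem_erase h.1))) hβ0
      linarith
    · exact le_rfl
  have hTcut : ∀ S : Finset V, (T.filter (fun e => ¬(e.1 ∈ S ↔ e.2 ∈ S))).card =
      (treeCut r K p S).card := fun S => by
    rw [hTdef, Finset.filter_image, Finset.card_image_of_injective _ hinj]
    rfl
  have hzcut : ∀ S : Finset V, r ∉ S → ∑ x ∈ S, D x = 1 →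
      1 ≤ ∑ e : V × V with ¬(e.1 ∈ S ↔ e.2 ∈ S), z e := by
    intro S hrS hS
    rw [hD, sum_joinBoundary, hTcut, ZMod.natCast_eq_one_iff_odd] at hS
    have := one_le_of_odd_treeCut hT hη hK hKW hKη hrS hβ0 hβ hβ2 hδ hy
      (fun v _ hvS => hcut S hrS v hvS) hS
    rw [Finset.sum_add_distrib, ← Finset.mul_sum, ← Finset.sum_div, sum_crossing_eq hXs,
      sum_ite_graph _ _ _ (fun e => 1 - 2 * β * η e.1)]
    simpa [treeCut] using this
  have hzcut' : ∀ S : Finset V, ∑ x ∈ S, D x = 1 →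
      1 ≤ ∑ e : V × V with ¬(e.1 ∈ S ↔ e.2 ∈ S), z e := by
    intro S hS
    by_cases hrS : r ∈ S
    · have huniv : ∑ x, D x = 0 := by
        rw [hD, sum_joinBoundary]
        simp
      have hSc : ∑ x ∈ Sᶜ, D x = 1 := by
        rw [← Finset.sum_add_sum_compl S, hS] at huniv
        generalize ∑ x ∈ Sᶜ, D x = d at huniv
        revert d
        decide
      have := hzcut Sᶜ (by simpa using hrS) hSc
      simpa [Finset.mem_compl, not_iff_not] using this
    · exact hzcut S hrS hS
  obtain ⟨J, hJ, hJcost⟩ := exists_join_sum_le _ Prod.fst Prod.snd (fun e => C e.1 e.2) z D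
    (fun e => hC0 _ _) hz ⟨T, rfl⟩ hzcut' (Nat.lt_succ_self _)
  have hsum : ∑ e, C e.1 e.2 * z e = β * ((∑ a, ∑ b, C a b * X a b) / 2) +
      ∑ u ∈ K.erase r, C u (p u) * (1 - 2 * β * η u) := by
    have h1 : ∀ e : V × V, C e.1 e.2 * z e = β * ((C e.1 e.2 * X e.1 e.2) / 2) +
        if e.1 ∈ K.erase r ∧ e.2 = p e.1 then C e.1 e.2 * (1 - 2 * β * η e.1) else 0 := fun e => by
      simp only [z]
      split_ifs <;> ring
    rw [Finset.sum_congr rfl fun e _ => h1 e, Finset.sum_add_distrib, ← Finset.mul_sum,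
      ← Finset.sum_div, sum_ite_graph _ _ _ (fun e => C e.1 e.2 * (1 - 2 * β * η e.1)),
      Fintype.sum_prod_type]
    simp
  have hTsum : ∑ e ∈ T, C e.1 e.2 = ∑ u ∈ K.erase r, C u (p u) := by
    rw [hTdef, Finset.sum_image fun a _ b _ h => hinj h]
  obtain ⟨l, hKl, hl⟩ := exists_closed_walk (F := J.disjSum T) (W := K) (r := r) (C := C)
    (s := Sum.elim Prod.fst Prod.fst) (t := Sum.elim Prod.snd Prod.snd)
    (ℓ := Sum.elim (fun e => C e.1 e.2) (fun e => C e.1 e.2))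
    (by
      have : joinBoundary (Sum.elim Prod.fst Prod.fst) (Sum.elim Prod.snd Prod.snd) (J.disjSum T) =
          joinBoundary Prod.fst Prod.snd J + joinBoundary Prod.fst Prod.snd T :=
        Finset.sum_disjSum _ _ _
      rw [this, hJ, ← hD, add_self_eq_zero_of_zmod_two])
    hCs hCd hC0 (by rintro (e | e) <;> exact le_rfl)
    (fun S hrS hne => by
      obtain ⟨u, hu, hpu⟩ := hK.2.2 (S ∩ K) (fun a ha => by
        rw [Finset.mem_inter] at ha
        exact Finset.mem_erase.2 ⟨fun h => hrS (h ▸ ha.1), ha.2⟩) hne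
      rw [Finset.mem_inter] at hu hpu
      have hur : u ≠ r := fun h => hrS (h ▸ hu.1)
      have hpK := hK.2.1 u hu.2 hur
      refine ⟨Sum.inr (u, p u), ?_, ?_⟩
      · rw [Finset.inr_mem_disjSum]
        exact Finset.mem_image_of_mem _ (Finset.mem_erase.2 ⟨hur, hu.2⟩)
      · simp only [Sum.elim_inr]
        tauto)
  refine ⟨l, hKl, hl.trans ?_⟩
  rw [Finset.sum_disjSum]
  simp only [Sum.elim_inl, Sum.elim_inr]
  rw [hTsum]
  rw [hsum] at hJcost
  have : ∑ u ∈ K.erase r, C u (p u) * (2 - 2 * β * η u) =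
      ∑ u ∈ K.erase r, C u (p u) * (1 - 2 * β * η u) + ∑ u ∈ K.erase r, C u (p u) := by
    rw [← Finset.sum_add_distrib]
    exact Finset.sum_congr rfl fun u _ => by ring
  linarith

theorem exists_closed_walk_le {δ κ α : ℝ} (hδ0 : 0 ≤ δ) (hδ1 : δ < 1) (hκ1 : κ ≤ 1)
    (hα₁ : (7 - 2 * δ - 2 * κ) / (3 - δ) ≤ α) (hα₂ : (3 - δ) / (3 - δ - κ) ≤ α)
    (hα₃ : 1 / (1 - δ) ≤ α)
    (hC0 : ∀ a b, 0 ≤ C a b) (hCs : ∀ a b, C a b = C b a) (hCd : ∀ a, C a a = 0)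
    (htri : ∀ a b d, C a d ≤ C a b + C b d)
    (hX0 : ∀ a b, 0 ≤ X a b) (hXs : ∀ a b, X a b = X b a) (hXd : ∀ a, X a a = 0)
    (hπ : ∀ v, 0 ≤ π v) (hπr : π r = 0) (hy0 : ∀ v, 0 ≤ y v) (hy1 : ∀ v, y v ≤ 1) (hyr : y r = 1)
    (hcut : ∀ S : Finset V, r ∉ S → ∀ v ∈ S, 2 * y v ≤ ∑ a ∈ S, ∑ b ∈ Sᶜ, X a b) :
    ∃ l : List V, pathCost C (r :: (l ++ [r])) +
        ∑ v ∈ Finset.univ \ (r :: (l ++ [r])).toFinset, π v ≤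
      α * ((∑ a, ∑ b, C a b * X a b) / 2 + ∑ v, π v * (1 - y v)) := by
  classical
  set β := 1 / (3 - δ) with hβdef
  have hβ0 : 0 ≤ β := div_nonneg zero_le_one (by linarith)
  have hβ : β * (3 - δ) = 1 := div_mul_cancel₀ _ (by linarith)
  have hβ2 : 2 * β ≤ 1 := by nlinarith
  have hβκ' : β * κ ≤ β := mul_le_of_le_one_right hβ0 hκ1
  have hβκ : β * κ < 1 := by linarith
  set B := 2 - 2 * β * κ with hB
  have hB0 : 0 < B := by rw [hB]; linarith
  set G := survival β κ with hG
  set Z := Finset.univ.filter (fun v => y v < δ) with hZ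
  set q : V → ℝ := fun v => if v ∈ Z then 0 else π v * G (y v) / 2 with hq
  have hinst : IsTreeInstance r Finset.univ Z (fun a b => B * C a b) X q y :=
    { root_mem := Finset.mem_univ r
      root_notMem := by simp [hZ, hyr, hδ1.le]
      w_nonneg := fun a _ b _ _ => mul_nonneg hB0.le (hC0 a b)
      w_symm := fun a b => by rw [hCs]
      w_triangle := fun z _ _ a _ b _ _ _ _ => by
        have := mul_le_mul_of_nonneg_left (htri a z b) hB0.le
        linarith
      x_nonneg := hX0
      x_symm := hXs
      x_diag := hXd
      q_nonneg := fun a => by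
        simp only [hq]
        split_ifs
        · exact le_rfl
        · have := mul_nonneg (hπ a) (survival_nonneg hβ0 hβκ (y a))
          linarith
      q_root := by simp [hq, hπr]
      q_steiner := fun z hz => by simp only [hq, if_pos hz]
      q_notMem := fun a ha => absurd (Finset.mem_univ a) ha
      y_le_one := hy1
      cut := fun S _ hrS t ht _ => by
        rw [← Finset.compl_eq_univ_sdiff]
        exact hcut S hrS t ht }
  obtain ⟨W, p, hT, hWZ, hcost⟩ := hinst.hasCheapTree _ (Nat.lt_succ_self _)
  have hWδ : ∀ v ∈ W, v ∉ Z := fun v hv => (Finset.mem_sdiff.1 (hWZ hv)).2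
  obtain ⟨η, hη⟩ := hT.exists_isSubtreeMax y
  have hGmem : ∀ t, 0 ≤ G t ∧ G t ≤ 1 := fun t =>
    ⟨survival_nonneg hβ0 hβκ t, survival_le_one hβ0 hβκ t⟩
  obtain ⟨θ, -, hθ1, hθ⟩ := exists_threshold_sum_le ((W.erase r).disjSum W)
    (Sum.elim (fun u => C u (p u) * (2 - 2 * β * η u)) (fun v => -π v))
    (Sum.elim (fun u => G (η u)) (fun v => G (y v))) (by rintro (u | u) _ <;> exact hGmem _)
  rw [Finset.sum_disjSum, Finset.sum_disjSum] at hθ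
  change (∑ u ∈ W.erase r, if θ ≤ G (η u) then C u (p u) * (2 - 2 * β * η u) else 0) +
    (∑ v ∈ W, if θ ≤ G (y v) then -π v else 0) ≤
    ∑ u ∈ W.erase r, C u (p u) * (2 - 2 * β * η u) * G (η u) + ∑ v ∈ W, -π v * G (y v) at hθ
  set K := W.filter (fun u => θ ≤ G (η u)) with hKdef
  have hKr : θ ≤ G (η r) := by
    rw [hG, survival_of_le hβκ (hκ1.trans (hyr.symm.le.trans (hη.le r hT.1)))]
    exact hθ1
  have hK : IsRootedTree r K p := hT.filter hKr fun u hu hur h =>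
    h.trans (survival_mono hβ0 hβκ (hη.mono u hu hur))
  obtain ⟨l, hKl, hl⟩ := exists_closed_walk_of_core hC0 hCs hCd hX0 hXs hcut hβ0 hβ hβ2 hT hη hK
    (Finset.filter_subset _ _)
    (fun a ha b hb hab => Finset.mem_filter.2 ⟨ha, hab ▸ (Finset.mem_filter.1 hb).2⟩)
    (fun v hv => by simpa [hZ] using hWδ v hv) (fun v _ => hy1 v)
  refine ⟨l, ?_⟩
  set cx := (∑ a, ∑ b, C a b * X a b) / 2 with hcx
  have hcx0 : 0 ≤ cx := div_nonneg (Finset.sum_nonneg fun a _ => Finset.sum_nonneg fun b _ =>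
    mul_nonneg (hC0 a b) (hX0 a b)) zero_le_two
  have hBcx : (∑ a, ∑ b, B * C a b * X a b) / 2 = B * cx := by
    simp only [mul_assoc, ← Finset.mul_sum]
    rw [hcx]
    ring
  have hKsum : ∑ u ∈ K.erase r, C u (p u) * (2 - 2 * β * η u) =
      ∑ u ∈ W.erase r, if θ ≤ G (η u) then C u (p u) * (2 - 2 * β * η u) else 0 := by
    rw [← Finset.sum_filter, hKdef, Finset.filter_erase]
  have hWsum : ∑ u ∈ W.erase r, C u (p u) * (2 - 2 * β * η u) * G (η u) ≤
      ∑ u ∈ W.erase r, B * C u (p u) := Finset.sum_le_sum fun u _ => by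
    have := mul_le_mul_of_nonneg_left (survival_mul_le hβ0 hβκ (η u)) (hC0 u (p u))
    rw [mul_assoc, mul_comm B]
    exact this
  have hpen : ∑ v ∈ Finset.univ \ (r :: (l ++ [r])).toFinset, π v ≤
      ∑ v, π v + ∑ v ∈ W, if θ ≤ G (y v) then -π v else 0 := by
    have h1 : ∑ v ∈ Finset.univ \ (r :: (l ++ [r])).toFinset, π v ≤
        ∑ v ∈ Finset.univ \ W.filter (fun v => θ ≤ G (y v)), π v := by
      refine Finset.sum_le_sum_of_subset_of_nonneg
        (Finset.sdiff_subset_sdiff le_rfl fun v hv => hKl ?_) fun v _ _ => hπ v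
      rw [Finset.mem_filter] at hv
      exact Finset.mem_filter.2 ⟨hv.1, hv.2.trans (survival_mono hβ0 hβκ (hη.le v hv.1))⟩
    have h2 := Finset.sum_sdiff (f := π) (Finset.subset_univ (W.filter (fun v => θ ≤ G (y v))))
    rw [← Finset.sum_filter, Finset.sum_neg_distrib]
    linarith
  have hqsum : 2 * ∑ v ∈ Finset.univ \ W, q v + ∑ v ∈ W, π v * G (y v) = 2 * ∑ v, q v := by
    rw [← Finset.sum_sdiff (f := q) (Finset.subset_univ W), mul_add, Finset.mul_sum W]
    congr 1
    refine Finset.sum_congr rfl fun v hv => ?_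
    simp only [hq, if_neg (hWδ v hv)]
    ring
  have hneg : ∑ v ∈ W, -π v * G (y v) = -∑ v ∈ W, π v * G (y v) := by
    rw [← Finset.sum_neg_distrib]
    exact Finset.sum_congr rfl fun v _ => by ring
  have hαβ : (β + B) * cx ≤ α * cx := by
    refine mul_le_mul_of_nonneg_right (le_trans (le_of_eq ?_) hα₁) hcx0
    rw [hB, hβdef]
    have : 3 - δ ≠ 0 := by linarith
    field_simp
    ring
  have hα1 : 1 ≤ α := le_trans ((le_div_iff₀ (by linarith)).2 (by linarith)) hα₃
  have hακ : 1 ≤ α * (1 - β * κ) := by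
    have h1 : (3 - δ) / (3 - δ - κ) * (1 - β * κ) = 1 := by
      have h2 : 3 - δ ≠ 0 := by linarith
      have h3 : 3 - δ - κ ≠ 0 := by linarith
      rw [hβdef]
      field_simp
    have := mul_le_mul_of_nonneg_right hα₂ (sub_nonneg.2 hβκ.le)
    linarith
  have hfinal : ∑ v, π v + 2 * ∑ v, q v * (1 - y v) - 2 * ∑ v, q v ≤
      α * ∑ v, π v * (1 - y v) := by
    rw [Finset.mul_sum, Finset.mul_sum, Finset.mul_sum, ← Finset.sum_add_distrib,
      ← Finset.sum_sub_distrib]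
    refine Finset.sum_le_sum fun v _ => ?_
    by_cases hv : v ∈ Z
    · have hvδ : y v < δ := by simpa [hZ] using hv
      simp only [hq, if_pos hv]
      have h1 : 1 ≤ α * (1 - y v) := by
        have h2 : 1 ≤ α * (1 - δ) := (div_le_iff₀ (by linarith)).1 hα₃
        have := mul_le_mul_of_nonneg_left hvδ.le (zero_le_one.trans hα1)
        linarith
      have := mul_le_mul_of_nonneg_left h1 (hπ v)
      linarith
    · simp only [hq, if_neg hv]
      have := mul_le_mul_of_nonneg_left
        (one_sub_survival_mul_le hβ0 hβκ hκ1 (hy0 v) (hy1 v) hα1 hακ) (hπ v)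
      rw [hG]
      linarith
  rw [hKsum] at hl
  rw [hneg] at hθ
  rw [hBcx] at hcost
  beta_reduce at hcost
  linarith

end

/-- for every `δ ∈ [0,1)` and `κ ∈ [δ,1]` there is a tour of value at most
`max{(7-2δ-2κ)/(3-δ), (3-δ)/(3-δ-κ), 1/(1-δ)}` times the LP value. -/
theorem pctsp_gap_le_alpha_kappa (δ κ : ℝ) (hδ0 : 0 ≤ δ) (hδ1 : δ < 1)
    (hκ0 : δ ≤ κ) (hκ1 : κ ≤ 1)
    (V : Type*) [Fintype V] [DecidableEq V]
    (hV : 2 ≤ Fintype.card V) (r : V)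
    (c : Finset V → ℝ) (π : V → ℝ)
    (hc : ∀ e ∈ completeEdges V, 0 ≤ c e)
    (htri : ∀ u v w : V, u ≠ v → v ≠ w → u ≠ w → c {u, w} ≤ c {u, v} + c {v, w})
    (hπ : ∀ v : V, 0 ≤ π v) (hπr : π r = 0)
    (x : Finset V → ℝ) (y : V → ℝ) (hxy : IsFeasibleLP r x y) :
    ∃ t : List V, t.Nodup ∧ t.head? = some r ∧
      tourCost c t + ∑ v ∈ Finset.univ \ t.toFinset, π v ≤
        max (max ((7 - 2 * δ - 2 * κ) / (3 - δ)) ((3 - δ) / (3 - δ - κ))) (1 / (1 - δ)) *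
          (∑ e ∈ completeEdges V, c e * x e + ∑ v : V, π v * (1 - y v)) := by
  obtain ⟨hx0, hy0, hyr, -, hdegr, hcut⟩ := hxy
  have hmem : ∀ a b : V, a ≠ b → ({a, b} : Finset V) ∈ completeEdges V := fun a b hab => by
    simp [completeEdges, Finset.mem_powersetCard, Finset.card_pair hab]
  let C : V → V → ℝ := fun a b => if a = b then 0 else c {a, b}
  let X : V → V → ℝ := fun a b => if a = b then 0 else x {a, b}
  have hC : ∀ a b, a ≠ b → C a b = c {a, b} := fun a b hab => if_neg hab
  have hC0 : ∀ a b, 0 ≤ C a b := fun a b => by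
    simp only [C]
    split_ifs with h
    · exact le_rfl
    · exact hc _ (hmem a b h)
  have hX0 : ∀ a b, 0 ≤ X a b := fun a b => by
    simp only [X]
    split_ifs with h
    · exact le_rfl
    · exact hx0 _ (hmem a b h)
  have hCs : ∀ a b, C a b = C b a := fun a b => by
    simp only [C, eq_comm (a := a), Finset.pair_comm a]
  have hXs : ∀ a b, X a b = X b a := fun a b => by
    simp only [X, eq_comm (a := a), Finset.pair_comm a]
  have hCtri : ∀ a b d, C a d ≤ C a b + C b d := fun a b d => by
    by_cases hab : a = b
    · simp [C, hab]
    · by_cases hbd : b = d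
      · simp [C, hbd]
      · by_cases had : a = d
        · have : C a d = 0 := if_pos had
          linarith [hC0 a b, hC0 b d]
        · rw [hC a b hab, hC b d hbd, hC a d had]
          exact htri a b d hab hbd had
  have hcutX : ∀ S : Finset V, ∑ e ∈ cutEdges V S, x e = ∑ a ∈ S, ∑ b ∈ Sᶜ, X a b := fun S => by
    rw [sum_cutEdges]
    refine Finset.sum_congr rfl fun a ha => Finset.sum_congr rfl fun b hb => ?_
    rw [Finset.mem_compl] at hb
    have hab : a ≠ b := fun h => hb (h ▸ ha)
    simp only [X, if_neg hab]
  have hy1 : ∀ v, y v ≤ 1 := fun v => by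
    by_cases hv : v = r
    · rw [hv, hyr]
    · have h1 := hcut {r}ᶜ (by simp) v (by simpa using hv)
      rw [hcutX, compl_compl, Finset.sum_comm] at h1
      rw [hcutX] at hdegr
      rw [Finset.sum_singleton] at h1 hdegr
      have : ∑ a ∈ {r}ᶜ, X a r = ∑ a ∈ {r}ᶜ, X r a := Finset.sum_congr rfl fun a _ => hXs a r
      linarith
  obtain ⟨l, hl⟩ := exists_closed_walk_le hδ0 hδ1 hκ1
    ((le_max_left _ _).trans (le_max_left _ _)) ((le_max_right _ _).trans (le_max_left _ _))
    (le_max_right (max ((7 - 2 * δ - 2 * κ) / (3 - δ)) ((3 - δ) / (3 - δ - κ))) (1 / (1 - δ)))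
    hC0 hCs (fun a => if_pos rfl) hCtri hX0 hXs (fun a => if_pos rfl) hπ hπr hy0 hy1 hyr
    (fun S hrS v hv => hcutX S ▸ hcut S hrS v hv)
  obtain ⟨t, hnd, hhead, hsub, ht⟩ := exists_tour_of_pathCost hC hC0 hCtri r l
  refine ⟨t, hnd, hhead, (add_le_add ht (Finset.sum_le_sum_of_subset_of_nonneg
    (Finset.sdiff_subset_sdiff le_rfl hsub) fun v _ _ => hπ v)).trans (hl.trans (le_of_eq ?_))⟩
  have hsum : (∑ a, ∑ b, C a b * X a b) / 2 = ∑ e ∈ completeEdges V, c e * x e := by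
    rw [div_eq_iff two_ne_zero, mul_comm _ (2 : ℝ), two_mul_sum_completeEdges]
    refine Finset.sum_congr rfl fun a _ => Finset.sum_congr rfl fun b _ => ?_
    simp only [C, X]
    split_ifs <;> ring
  rw [hsum]
end

section
/- Let κ₀ = 0.3724 and κ = 0.9971, and define ν := ((3−κ)(κ−κ₀)^{3.2}/3.2 + (κ−κ₀)^{4.2}/4.2)^{−1}. For y ∈ [κ₀, κ], let φ_y(δ) := (3−δ−κ)(3−δ)/(3−δ−y) and define h_y := 1 − (y·ν/(κ−κ₀)) · ( (φ_y(κ₀) − φ_y(κ)) · ((κ−κ₀)^{4.2} − (κ−y)^{4.2})/4.2 + φ_y(κ) · (κ−κ₀) · ((κ−κ₀)^{3.2} − (κ−y)^{3.2})/3.2 ). Then 1/(1−κ₀) < 1.599 and h_y/(1−y) < 1.599 for every y ∈ [κ₀, κ]. -/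
/-- `κ₀ = 0.3724`. -/
noncomputable def kap0 : ℝ := 0.3724

/-- `κ = 0.9971`. -/
noncomputable def kap : ℝ := 0.9971

/-- The normalization constant `ν = ((3-κ)(κ-κ₀)^{3.2}/3.2 + (κ-κ₀)^{4.2}/4.2)⁻¹`. -/
noncomputable def nuConst : ℝ :=
  ((3 - kap) * (kap - kap0) ^ (3.2 : ℝ) / 3.2 + (kap - kap0) ^ (4.2 : ℝ) / 4.2)⁻¹

/-- `φ_y(δ) = (3-δ-κ)(3-δ)/(3-δ-y)`. -/
noncomputable def phiFun (y δ : ℝ) : ℝ := (3 - δ - kap) * (3 - δ) / (3 - δ - y)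

/-- The penalty bound `h_y`. -/
noncomputable def hFun (y : ℝ) : ℝ :=
  1 - (y * nuConst / (kap - kap0)) *
    ((phiFun y kap0 - phiFun y kap) *
        ((kap - kap0) ^ (4.2 : ℝ) - (kap - y) ^ (4.2 : ℝ)) / 4.2 +
      phiFun y kap * (kap - kap0) *
        ((kap - kap0) ^ (3.2 : ℝ) - (kap - y) ^ (3.2 : ℝ)) / 3.2)

theorem five_mul_pow_four_mul_le {u c : ℝ} (hu : 0 ≤ u) (hc : 0 ≤ c) :
    5 * c ^ 4 * u ≤ u ^ 5 + 4 * c ^ 5 := by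
  have h : u ^ 5 + 4 * c ^ 5 - 5 * c ^ 4 * u =
      (u - c) ^ 2 * (u ^ 3 + 2 * c * u ^ 2 + 3 * c ^ 2 * u + 4 * c ^ 3) := by ring
  have : 0 ≤ (u - c) ^ 2 * (u ^ 3 + 2 * c * u ^ 2 + 3 * c ^ 2 * u + 4 * c ^ 3) := by positivity
  linarith

/-- The coefficient of `s ^ 3.2` after clearing the denominators of `phiFun`, in the variable
`s = (κ - y) / (κ - κ₀)`. -/
noncomputable def powerCoeff (s : ℝ) : ℝ :=
  (0.9971 - 0.6247 * s) *
    (1.6305 * 2.6276 * (2.0029 - (0.9971 - 0.6247 * s)) * (s * (5 / 21)) +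
      1.0058 * 2.0029 * (2.6276 - (0.9971 - 0.6247 * s)) * (5 / 16 - s * (5 / 21)))

/-- The polynomial part after clearing the denominators of `phiFun`, in the variable
`s = (κ - y) / (κ - κ₀)`. -/
noncomputable def polyPart (s : ℝ) : ℝ :=
  (0.9971 - 0.6247 * s) *
    (1.6305 * 2.6276 * (2.0029 - (0.9971 - 0.6247 * s)) * (5 / 21) +
      1.0058 * 2.0029 * (2.6276 - (0.9971 - 0.6247 * s)) * (5 / 16 - 5 / 21)) -
  (2.0029 * (5 / 16) + 0.6247 * (5 / 21)) * (1 - 1.599 * (0.0029 + 0.6247 * s)) *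
    ((2.6276 - (0.9971 - 0.6247 * s)) * (2.0029 - (0.9971 - 0.6247 * s)))

theorem powerCoeff_nonneg {s : ℝ} (h0 : 0 ≤ s) (h1 : s ≤ 1) : 0 ≤ powerCoeff s := by
  have e1 : 0 ≤ 0.9971 - 0.6247 * s := by linarith
  have e2 : 0 ≤ 2.0029 - (0.9971 - 0.6247 * s) := by linarith
  have e3 : 0 ≤ 2.6276 - (0.9971 - 0.6247 * s) := by linarith
  have e4 : 0 ≤ 5 / 16 - s * (5 / 21) := by linarith
  unfold powerCoeff
  positivity

/-- Degree 7 Bernstein basis nonnegativity on `[a, b]`. -/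
theorem bernstein_seven_nonneg {a b s : ℝ} (ha : a ≤ s) (hb : s ≤ b) (i j : ℕ) :
    0 ≤ (s - a) ^ i * (b - s) ^ j :=
  mul_nonneg (pow_nonneg (sub_nonneg.2 ha) i) (pow_nonneg (sub_nonneg.2 hb) j)

theorem pow_mul_powerCoeff_lt_of_tangent {s u c : ℝ} (h0 : 0 ≤ s) (h1 : s ≤ 1) (hu : 0 ≤ u)
    (hus : u ^ 5 = s) (hc : 0 < c)
    (h : s ^ 3 * (s + 4 * c ^ 5) * powerCoeff s < 5 * c ^ 4 * polyPart s) :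
    s ^ 3 * u * powerCoeff s < polyPart s := by
  have hR := powerCoeff_nonneg h0 h1
  have ht := five_mul_pow_four_mul_le hu hc.le
  rw [hus] at ht
  have hm : s ^ 3 * powerCoeff s * (5 * c ^ 4 * u) ≤ s ^ 3 * powerCoeff s * (s + 4 * c ^ 5) :=
    mul_le_mul_of_nonneg_left ht (by positivity)
  refine lt_of_mul_lt_mul_left (a := 5 * c ^ 4) ?_ (by positivity)
  linarith

theorem pow_mul_powerCoeff_lt {s u : ℝ} (h0 : 0 ≤ s) (h1 : s ≤ 1) (hu : 0 ≤ u)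
    (hus : u ^ 5 = s) : s ^ 3 * u * powerCoeff s < polyPart s := by
  have key {a b : ℝ} (ha : a ≤ s) (hb : s ≤ b) := bernstein_seven_nonneg ha hb
  rcases le_total s 0.0725 with hb | ha
  · refine pow_mul_powerCoeff_lt_of_tangent h0 h1 hu hus (c := 0.515) (by norm_num) ?_
    unfold powerCoeff polyPart
    have B := key h0 hb
    linarith [B 0 7, B 1 6, B 2 5, B 3 4, B 4 3, B 5 2, B 6 1, B 7 0]
  rcases le_total s 0.765 with hb | ha
  · refine pow_mul_powerCoeff_lt_of_tangent h0 h1 hu hus (c := 0.84) (by norm_num) ?_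
    unfold powerCoeff polyPart
    have B := key ha hb
    linarith [B 0 7, B 1 6, B 2 5, B 3 4, B 4 3, B 5 2, B 6 1, B 7 0]
  rcases le_total s 0.9175 with hb | ha
  · refine pow_mul_powerCoeff_lt_of_tangent h0 h1 hu hus (c := 0.976) (by norm_num) ?_
    unfold powerCoeff polyPart
    have B := key ha hb
    linarith [B 0 7, B 1 6, B 2 5, B 3 4, B 4 3, B 5 2, B 6 1, B 7 0]
  · refine pow_mul_powerCoeff_lt_of_tangent h0 h1 hu hus (c := 0.992) (by norm_num) ?_
    unfold powerCoeff polyPart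
    have B := key ha h1
    linarith [B 0 7, B 1 6, B 2 5, B 3 4, B 4 3, B 5 2, B 6 1, B 7 0]

theorem rpow_natCast_add_fifth {s : ℝ} (hs : 0 ≤ s) (n : ℕ) :
    s ^ ((n : ℝ) + 0.2) = s ^ n * s ^ (0.2 : ℝ) := by
  rw [Real.rpow_add_of_nonneg hs (by positivity) (by norm_num), Real.rpow_natCast]

theorem hFun_eq {s : ℝ} (h0 : 0 ≤ s) :
    hFun (0.9971 - 0.6247 * s) = 1.599 * (0.0029 + 0.6247 * s) -
      (polyPart s - s ^ 3 * s ^ (0.2 : ℝ) * powerCoeff s) /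
        ((2.0029 * (5 / 16) + 0.6247 * (5 / 21)) * ((2.6276 - (0.9971 - 0.6247 * s)) *
          (2.0029 - (0.9971 - 0.6247 * s)))) := by
  have hL : kap - kap0 = 0.6247 := by norm_num [kap, kap0]
  have hy : kap - (0.9971 - 0.6247 * s) = 0.6247 * s := by norm_num [kap]
  have p3 {x : ℝ} (hx : 0 ≤ x) : x ^ (3.2 : ℝ) = x ^ 3 * x ^ (0.2 : ℝ) := by
    rw [← rpow_natCast_add_fifth hx]; norm_num
  have p4 {x : ℝ} (hx : 0 ≤ x) : x ^ (4.2 : ℝ) = x ^ 4 * x ^ (0.2 : ℝ) := by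
    rw [← rpow_natCast_add_fifth hx]; norm_num
  have hLs : (0 : ℝ) ≤ 0.6247 * s := by positivity
  unfold hFun nuConst phiFun
  rw [hL, hy, p3 hLs, p4 hLs, p3 (by norm_num : (0 : ℝ) ≤ 0.6247),
    p4 (by norm_num : (0 : ℝ) ≤ 0.6247), Real.mul_rpow (by norm_num) h0]
  have hv : (0 : ℝ) < (0.6247 : ℝ) ^ (0.2 : ℝ) := Real.rpow_pos_of_pos (by norm_num) _
  generalize (0.6247 : ℝ) ^ (0.2 : ℝ) = v at hv ⊢
  generalize s ^ (0.2 : ℝ) = u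
  have a0 : 3 - kap0 = 2.6276 := by norm_num [kap0]
  have a1 : 3 - kap = 2.0029 := by norm_num [kap]
  have a2 : (2.6276 : ℝ) - kap = 1.6305 := by norm_num [kap]
  have a3 : (2.0029 : ℝ) - kap = 1.0058 := by norm_num [kap]
  rw [a0, a1, a2, a3]
  unfold polyPart powerCoeff
  have e2 : 0 < 2.0029 - (0.9971 - 0.6247 * s) := by linarith
  have e3 : 0 < 2.6276 - (0.9971 - 0.6247 * s) := by linarith
  have hC : (2.0029 * ((0.6247 : ℝ) ^ 3 * v) / 3.2 + 0.6247 ^ 4 * v / 4.2)⁻¹ =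
      (2.0029 * (5 / 16) + 0.6247 * (5 / 21))⁻¹ * (0.6247 ^ 3)⁻¹ * v⁻¹ := by
    rw [← mul_inv, ← mul_inv]; congr 1; ring
  rw [hC]
  generalize hd2 : 2.0029 - (0.9971 - 0.6247 * s) = d2 at *
  generalize hd3 : 2.6276 - (0.9971 - 0.6247 * s) = d3 at *
  field_simp
  ring

/-- with `κ₀ = 0.3724` and `κ = 0.9971`, one has `1/(1-κ₀) < 1.599` and
`h_y/(1-y) < 1.599` for every `y ∈ [κ₀, κ]`. -/
theorem h_lt_1599 :
    1 / (1 - kap0) < 1.599 ∧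
    ∀ y : ℝ, kap0 ≤ y → y ≤ kap → hFun y / (1 - y) < 1.599 := by
  refine ⟨by norm_num [kap0], fun y hy0 hy1 => ?_⟩
  unfold kap0 at hy0
  unfold kap at hy1
  obtain ⟨s, hs⟩ : ∃ s, y = 0.9971 - 0.6247 * s := ⟨(0.9971 - y) / 0.6247, by ring⟩
  have h0 : 0 ≤ s := by linarith
  have h1 : s ≤ 1 := by linarith
  have e2 : 0 < 2.0029 - (0.9971 - 0.6247 * s) := by linarith
  have e3 : 0 < 2.6276 - (0.9971 - 0.6247 * s) := by linarith
  have hus : (s ^ (0.2 : ℝ)) ^ 5 = s := by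
    rw [← Real.rpow_natCast, ← Real.rpow_mul h0]; norm_num
  have hlt := sub_pos.2 (pow_mul_powerCoeff_lt h0 h1 (Real.rpow_nonneg h0 _) hus)
  rw [div_lt_iff₀ (by linarith), hs, hFun_eq h0]
  have : 0 < (polyPart s - s ^ 3 * s ^ (0.2 : ℝ) * powerCoeff s) /
      ((2.0029 * (5 / 16) + 0.6247 * (5 / 21)) * ((2.6276 - (0.9971 - 0.6247 * s)) *
        (2.0029 - (0.9971 - 0.6247 * s)))) := by positivity
  linarith
end
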